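/- arXiv:1802.03659 — 2 statements merged into one kernel-verified Lean document; each statement's English description precedes it below -/
import Mathlib

section
/- Let g : [0,T]×[0,T]×ℝ^n×ℝ^n×ℝ^m×ℝ^{m×d} → ℝ^m be bounded by L, continuously differentiable with all first derivatives bounded by L and Lipschitz with constant L, and let σ : [0,T]×ℝ^n → ℝ^{n×d} be bounded by L and Lipschitz in (s,x) with constant L. Let M > 0. Then there is a constant K, depending only on L, M, T and α, such that for every S ∈ [0,T), every θ, θ̂ ∈ X[S,T] with ‖θ‖_{X[S,T]} ≤ M and ‖θ̂‖_{X[S,T]} ≤ M, and every (t,ξ) ∈ [0,T]×ℝ^n, the function f(τ,η) := g(t,τ,ξ,η, θ(τ,τ,η,η), θ_η(t,τ,ξ,η)σ(τ,η)) − g(t,τ,ξ,η, θ̂(τ,τ,η,η), θ̂_η(t,τ,ξ,η)σ(τ,η)), defined for (τ,η) ∈ [max(t,S),T]×ℝ^n, satisfies |f|^{(α)}_{[max(t,S),T]×ℝ^n} ≤ K ‖θ − θ̂‖_{X[S,T]}. -/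
open scoped ENNReal NNReal BigOperators
open Set

noncomputable section

abbrev En (n : ℕ) : Type := EuclideanSpace ℝ (Fin n)

def sing (n : ℕ) (i : Fin n) : En n := EuclideanSpace.single i (1 : ℝ)

variable {n m : ℕ}

/-- sup norm `|φ|⁽⁰⁾` over `[S,T] × ℝⁿ`. -/
def nrm0 {V : Type*} [NormedAddCommGroup V] (S T : ℝ) (φ : ℝ → En n → V) : ℝ≥0∞ :=
  ⨆ (s : Icc S T) (x : En n), (‖φ s.1 x‖₊ : ℝ≥0∞)

/-- time Hölder seminorm `⟨φ⟩ₛ^(β)` over `[S,T] × ℝⁿ`. -/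
def hS {V : Type*} [NormedAddCommGroup V] (S T β : ℝ) (φ : ℝ → En n → V) : ℝ≥0∞ :=
  ⨆ (s : Icc S T) (s' : Icc S T) (x : En n),
    (‖φ s.1 x - φ s'.1 x‖₊ : ℝ≥0∞) / ENNReal.ofReal (|s.1 - s'.1| ^ β)

/-- space Hölder seminorm `⟨φ⟩ₓ^(α)` over `[S,T] × ℝⁿ`. -/
def hX {V : Type*} [NormedAddCommGroup V] (S T α : ℝ) (φ : ℝ → En n → V) : ℝ≥0∞ :=
  ⨆ (s : Icc S T) (x : En n) (x' : En n) (_ : dist x x' ≤ 1),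
    (‖φ s.1 x - φ s.1 x'‖₊ : ℝ≥0∞) / ENNReal.ofReal (dist x x' ^ α)

/-- `⟨φ⟩^(α) = ⟨φ⟩ₛ^(α/2) + ⟨φ⟩ₓ^(α)`. -/
def hol {V : Type*} [NormedAddCommGroup V] (S T α : ℝ) (φ : ℝ → En n → V) : ℝ≥0∞ :=
  hS S T (α/2) φ + hX S T α φ

/-- `|φ|^(α)`. -/
def nrmA {V : Type*} [NormedAddCommGroup V] (S T α : ℝ) (φ : ℝ → En n → V) : ℝ≥0∞ :=
  nrm0 S T φ + hol S T α φ

/-- spatial gradient. -/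
def Dx {V : Type*} [NormedAddCommGroup V] [NormedSpace ℝ V] (φ : ℝ → En n → V) :
    ℝ → En n → (En n →L[ℝ] V) := fun s x => fderiv ℝ (φ s) x

/-- spatial Hessian. -/
def Dxx {V : Type*} [NormedAddCommGroup V] [NormedSpace ℝ V] (φ : ℝ → En n → V) :
    ℝ → En n → (En n →L[ℝ] (En n →L[ℝ] V)) :=
  fun s x => fderiv ℝ (fun y => fderiv ℝ (φ s) y) x

/-- time derivative. -/
def Dt {V : Type*} [NormedAddCommGroup V] [NormedSpace ℝ V] (φ : ℝ → En n → V) :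
    ℝ → En n → V := fun s x => deriv (fun r => φ r x) s

/-- `|φ|^(1+α)`. -/
def nrm1A {V : Type*} [NormedAddCommGroup V] [NormedSpace ℝ V] (S T α : ℝ)
    (φ : ℝ → En n → V) : ℝ≥0∞ :=
  nrm0 S T φ + nrm0 S T (Dx φ) + hol S T α (Dx φ) + hS S T ((1+α)/2) φ

/-- `|φ|^(2+α)`. -/
def nrm2A {V : Type*} [NormedAddCommGroup V] [NormedSpace ℝ V] (S T α : ℝ)
    (φ : ℝ → En n → V) : ℝ≥0∞ :=
  nrm0 S T φ + nrm0 S T (Dx φ) + nrm0 S T (Dt φ) + nrm0 S T (Dxx φ)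
    + hol S T α (Dt φ) + hol S T α (Dxx φ) + hS S T ((1+α)/2) (Dx φ)

/-- sup norm over `ℝⁿ` (time–independent functions). -/
def xnrm0 {V : Type*} [NormedAddCommGroup V] (h : En n → V) : ℝ≥0∞ :=
  ⨆ x : En n, (‖h x‖₊ : ℝ≥0∞)

/-- Hölder seminorm over `ℝⁿ`. -/
def xhol {V : Type*} [NormedAddCommGroup V] (α : ℝ) (h : En n → V) : ℝ≥0∞ :=
  ⨆ (x : En n) (x' : En n) (_ : dist x x' ≤ 1),
    (‖h x - h x'‖₊ : ℝ≥0∞) / ENNReal.ofReal (dist x x' ^ α)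

/-- `|h|^(1+α)` on `ℝⁿ`. -/
def xnrm1A {V : Type*} [NormedAddCommGroup V] [NormedSpace ℝ V] (α : ℝ)
    (h : En n → V) : ℝ≥0∞ :=
  xnrm0 h + xnrm0 (fderiv ℝ h) + xhol α (fderiv ℝ h)

/-- `|h|^(2+α)` on `ℝⁿ`. -/
def xnrm2A {V : Type*} [NormedAddCommGroup V] [NormedSpace ℝ V] (α : ℝ)
    (h : En n → V) : ℝ≥0∞ :=
  xnrm0 h + xnrm0 (fderiv ℝ h) + xnrm0 (fderiv ℝ (fderiv ℝ h))
    + xhol α (fderiv ℝ (fderiv ℝ h))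

/-- uniform parabolicity (P1). -/
def P1 (n : ℕ) (T lam0 : ℝ) (a : ℝ → En n → Fin n → Fin n → ℝ) : Prop :=
  ∀ s ∈ Icc (0:ℝ) T, ∀ x ζ : En n,
    lam0 * ‖ζ‖^2 ≤ ∑ i, ∑ j, a s x i j * ζ i * ζ j

/-- regularity of the coefficients (P2). -/
def P2 (n : ℕ) (T α K0 : ℝ) (a : ℝ → En n → Fin n → Fin n → ℝ)
    (b : ℝ → En n → Fin n → ℝ) : Prop :=
  (∀ i j, ContinuousOn (fun p : ℝ × En n => a p.1 p.2 i j) (Icc 0 T ×ˢ univ)) ∧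
  (∀ i, ContinuousOn (fun p : ℝ × En n => b p.1 p.2 i) (Icc 0 T ×ˢ univ)) ∧
  (∃ C : ℝ, ∀ s ∈ Icc (0:ℝ) T, ∀ x : En n,
      (∀ i j, |a s x i j| ≤ C) ∧ (∀ i, |b s x i| ≤ C)) ∧
  (∀ i j, ∀ s ∈ Icc (0:ℝ) T, ∀ s' ∈ Icc (0:ℝ) T, ∀ x x' : En n,
      |a s x i j - a s' x' i j| ≤ K0 * (|s - s'| ^ (α/2) + ‖x - x'‖ ^ α)) ∧
  (∀ i, ∀ s ∈ Icc (0:ℝ) T, ∀ x x' : En n,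
      |b s x i - b s x' i| ≤ K0 * ‖x - x'‖ ^ α)

/-- bounded classical solution of the backward Cauchy problem (★) on `[S,T] × ℝⁿ`. -/
def IsClassicalSol (n : ℕ) (S T : ℝ) (a : ℝ → En n → Fin n → Fin n → ℝ)
    (b : ℝ → En n → Fin n → ℝ) (f : ℝ → En n → ℝ) (h : En n → ℝ)
    (v : ℝ → En n → ℝ) : Prop :=
  (∃ C : ℝ, ∀ s ∈ Icc S T, ∀ x : En n, |v s x| ≤ C) ∧
  ContinuousOn (fun p : ℝ × En n => v p.1 p.2) (Icc S T ×ˢ univ) ∧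
  (∀ x : En n, ∀ s ∈ Icc S T, DifferentiableAt ℝ (fun r => v r x) s) ∧
  (∀ s ∈ Icc S T, ContDiff ℝ 2 (v s)) ∧
  (∀ s ∈ Icc S T, ∀ x : En n,
    Dt v s x + (∑ i, ∑ j, a s x i j * Dxx v s x (sing n i) (sing n j))
      + (∑ i, b s x i * Dx v s x (sing n i)) + f s x = 0) ∧
  (∀ x : En n, v T x = h x)


/-- the `X[S,T]`-norm of `θ : Δ̂[S,T] × ℝⁿ × ℝⁿ → ℝᵐ`;  all inner norms are taken
over `[max(t,S),T] × ℝⁿ`. -/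
def Xnrm (n m : ℕ) (S T α : ℝ) (θ : ℝ → ℝ → En n → En n → En m) : ℝ≥0∞ :=
  ⨆ (t : Icc (0:ℝ) T) (ξ : En n),
    (nrm1A (max t.1 S) T α (fun s x => θ t.1 s ξ x)
      + nrm0 (max t.1 S) T (fun s x => deriv (fun r => θ r s ξ x) t.1)
      + nrm0 (max t.1 S) T (fun s x => fderiv ℝ (fun ξ' => θ t.1 s ξ' x) ξ)
      + nrm0 (max t.1 S) T
          (fun s x => deriv (fun r => fderiv ℝ (fun y => θ r s ξ y) x) t.1)
      + nrm0 (max t.1 S) T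
          (fun s x => fderiv ℝ (fun ξ' => fderiv ℝ (fun y => θ t.1 s ξ' y) x) ξ))

/-- membership in the Banach space `X[S,T]`. -/
def memX (n m : ℕ) (S T α : ℝ) (θ : ℝ → ℝ → En n → En n → En m) : Prop :=
  (∀ t ∈ Icc (0:ℝ) T, ∀ s ∈ Icc (max t S) T, ∀ ξ x : En n,
    DifferentiableAt ℝ (fun y => θ t s ξ y) x ∧
    DifferentiableAt ℝ (fun r => θ r s ξ x) t ∧
    DifferentiableAt ℝ (fun ξ' => θ t s ξ' x) ξ ∧
    DifferentiableAt ℝ (fun r => fderiv ℝ (fun y => θ r s ξ y) x) t ∧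
    DifferentiableAt ℝ (fun ξ' => fderiv ℝ (fun y => θ t s ξ' y) x) ξ) ∧
  Xnrm n m S T α θ ≠ ⊤


section helpers

lemma nrm0_le_iff {V : Type*} [NormedAddCommGroup V] {S T : ℝ} {φ : ℝ → En n → V} {C : ℝ≥0} :
    nrm0 S T φ ≤ C ↔ ∀ s ∈ Icc S T, ∀ x, ‖φ s x‖ ≤ C := by
  unfold nrm0
  simp only [iSup_le_iff, Subtype.forall, ENNReal.coe_le_coe]
  rfl

lemma div_ofReal_le_iff {a C : ℝ≥0} {r : ℝ} (hr : 0 ≤ r) (h0 : r = 0 → a = 0) :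
    (a : ℝ≥0∞) / ENNReal.ofReal r ≤ C ↔ (a : ℝ) ≤ C * r := by
  rcases hr.eq_or_lt with h | h
  · have ha := h0 h.symm
    subst ha
    simp [← h]
  · rw [ENNReal.div_le_iff (by simpa using h) (by simp), ← ENNReal.ofReal_coe_nnreal,
      ← ENNReal.ofReal_coe_nnreal, ← ENNReal.ofReal_mul C.coe_nonneg,
      ENNReal.ofReal_le_ofReal_iff (mul_nonneg C.coe_nonneg hr)]

lemma hS_le_iff {V : Type*} [NormedAddCommGroup V] {S T β : ℝ} (hβ : 0 < β)
    {φ : ℝ → En n → V} {C : ℝ≥0} :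
    hS S T β φ ≤ C ↔ ∀ s ∈ Icc S T, ∀ s' ∈ Icc S T, ∀ x,
      ‖φ s x - φ s' x‖ ≤ C * |s - s'| ^ β := by
  unfold hS
  simp only [iSup_le_iff, Subtype.forall]
  refine forall₂_congr fun s hs => forall₂_congr fun s' hs' => forall_congr' fun x => ?_
  rw [div_ofReal_le_iff (by positivity)]
  · rfl
  · intro h
    rw [Real.rpow_eq_zero (abs_nonneg _) hβ.ne', abs_eq_zero, sub_eq_zero] at h
    simp [h]

lemma hX_le_iff {V : Type*} [NormedAddCommGroup V] {S T β : ℝ} (hβ : 0 < β)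
    {φ : ℝ → En n → V} {C : ℝ≥0} :
    hX S T β φ ≤ C ↔ ∀ s ∈ Icc S T, ∀ x x', dist x x' ≤ 1 →
      ‖φ s x - φ s x'‖ ≤ C * dist x x' ^ β := by
  unfold hX
  simp only [iSup_le_iff, Subtype.forall]
  refine forall₂_congr fun s hs => forall₃_congr fun x x' _ => ?_
  rw [div_ofReal_le_iff (by positivity)]
  · rfl
  · intro h
    rw [Real.rpow_eq_zero dist_nonneg hβ.ne', dist_eq_zero] at h
    simp [h]

/-- four-point estimate -/
lemma four_point {E F : Type*} [NormedAddCommGroup E] [NormedSpace ℝ E]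
    [NormedAddCommGroup F] [NormedSpace ℝ F] {G : E → F} {L : ℝ} (hL : 0 ≤ L)
    (hG : Differentiable ℝ G) (hb : ∀ p, ‖fderiv ℝ G p‖ ≤ L)
    (hl : ∀ p q, ‖fderiv ℝ G p - fderiv ℝ G q‖ ≤ L * ‖p - q‖)
    (p ph q qh : E) {A B D : ℝ} (hA : ‖(p - ph) - (q - qh)‖ ≤ A) (hB : ‖p - q‖ ≤ B)
    (hB' : ‖ph - qh‖ ≤ B) (hD : ‖q - qh‖ ≤ D) :
    ‖(G p - G ph) - (G q - G qh)‖ ≤ L * A + L * B * D := by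
  have hB0 : 0 ≤ B := (norm_nonneg _).trans hB
  have hder : ∀ (a v : E) (r : ℝ), HasDerivAt (fun r : ℝ => G (a + r • v))
      (fderiv ℝ G (a + r • v) v) r := by
    intro a v r
    have h1 : HasDerivAt (fun r : ℝ => a + r • v) v r := by
      simpa using ((hasDerivAt_id r).smul_const v).const_add a
    exact (hG _).hasFDerivAt.comp_hasDerivAt r h1
  have key := norm_image_sub_le_of_norm_deriv_le_segment_01'
    (f := fun r : ℝ => G (ph + r • (p - ph)) - G (qh + r • (q - qh)))
    (f' := fun r => fderiv ℝ G (ph + r • (p - ph)) (p - ph)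
      - fderiv ℝ G (qh + r • (q - qh)) (q - qh)) (C := L * A + L * B * D)
    (fun r _ => ((hder _ _ r).sub (hder _ _ r)).hasDerivWithinAt) ?_
  · have e : (G p - G ph) - (G q - G qh) = (G p - G q) - (G ph - G qh) := by abel
    rw [e]
    simpa using key
  · intro r hr
    set a := ph + r • (p - ph) with ha
    set b := qh + r • (q - qh) with hb'
    have hab : ‖a - b‖ ≤ B := by
      have : a - b = (1 - r) • (ph - qh) + r • (p - q) := by
        rw [ha, hb']; module
      rw [this]
      calc _ ≤ ‖(1 - r) • (ph - qh)‖ + ‖r • (p - q)‖ := norm_add_le _ _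
        _ = (1 - r) * ‖ph - qh‖ + r * ‖p - q‖ := by
          rw [norm_smul, norm_smul, Real.norm_of_nonneg hr.1,
            Real.norm_of_nonneg (by linarith [hr.2])]
        _ ≤ (1 - r) * B + r * B := by
          have := hr.1; have := hr.2
          gcongr
        _ = B := by ring
    have e : fderiv ℝ G a (p - ph) - fderiv ℝ G b (q - qh)
        = fderiv ℝ G a ((p - ph) - (q - qh)) + (fderiv ℝ G a - fderiv ℝ G b) (q - qh) := by
      simp only [map_sub, sub_apply]; abel
    rw [e]
    refine (norm_add_le _ _).trans (add_le_add ?_ ?_)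
    · exact (ContinuousLinearMap.le_opNorm _ _).trans
        (mul_le_mul (hb _) hA (norm_nonneg _) hL)
    · refine (ContinuousLinearMap.le_opNorm _ _).trans
        (mul_le_mul ((hl _ _).trans ?_) hD (norm_nonneg _) (by positivity))
      gcongr

lemma rpow_cmp {T x β γ : ℝ} (hT : 0 < T) (hx : 0 ≤ x) (hxT : x ≤ T) (hβ : 0 < β)
    (h1 : β ≤ γ) (h2 : γ ≤ β + 1) : x ^ γ ≤ (1 + T) * x ^ β := by
  rcases hx.eq_or_lt with h | h
  · subst h
    rw [Real.zero_rpow (by linarith), Real.zero_rpow hβ.ne']; simp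
  · have e : γ = (γ - β) + β := by ring
    rw [e, Real.rpow_add h]
    gcongr
    calc x ^ (γ - β) ≤ (1 + T) ^ (γ - β) := by
          apply Real.rpow_le_rpow hx (by linarith) (by linarith)
      _ ≤ (1 + T) ^ (1 : ℝ) := Real.rpow_le_rpow_of_exponent_le (by linarith) (by linarith)
      _ = 1 + T := Real.rpow_one _

/-- pointwise consequences of an `X`-norm bound -/
structure Est (n m : ℕ) (S T α : ℝ) (C : ℝ) (θ : ℝ → ℝ → En n → En n → En m) : Prop where
  b0 : ∀ t ∈ Icc (0:ℝ) T, ∀ s ∈ Icc (max t S) T, ∀ ξ x, ‖θ t s ξ x‖ ≤ C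
  b1 : ∀ t ∈ Icc (0:ℝ) T, ∀ s ∈ Icc (max t S) T, ∀ ξ x, ‖fderiv ℝ (fun y => θ t s ξ y) x‖ ≤ C
  bt : ∀ t ∈ Icc (0:ℝ) T, ∀ s ∈ Icc (max t S) T, ∀ ξ x, ‖deriv (fun r => θ r s ξ x) t‖ ≤ C
  bξ : ∀ t ∈ Icc (0:ℝ) T, ∀ s ∈ Icc (max t S) T, ∀ ξ x,
    ‖fderiv ℝ (fun ξ' => θ t s ξ' x) ξ‖ ≤ C
  h0 : ∀ t ∈ Icc (0:ℝ) T, ∀ s ∈ Icc (max t S) T, ∀ s' ∈ Icc (max t S) T, ∀ ξ x,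
    ‖θ t s ξ x - θ t s' ξ x‖ ≤ C * |s - s'| ^ ((1 + α) / 2)
  h1 : ∀ t ∈ Icc (0:ℝ) T, ∀ s ∈ Icc (max t S) T, ∀ s' ∈ Icc (max t S) T, ∀ ξ x,
    ‖fderiv ℝ (fun y => θ t s ξ y) x - fderiv ℝ (fun y => θ t s' ξ y) x‖
      ≤ C * |s - s'| ^ (α / 2)
  hx : ∀ t ∈ Icc (0:ℝ) T, ∀ s ∈ Icc (max t S) T, ∀ ξ x x', dist x x' ≤ 1 →
    ‖fderiv ℝ (fun y => θ t s ξ y) x - fderiv ℝ (fun y => θ t s ξ y) x'‖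
      ≤ C * dist x x' ^ α

lemma est_of_Xnrm {S T α : ℝ} (hα : 0 < α) {C : ℝ≥0} {θ : ℝ → ℝ → En n → En n → En m}
    (h : Xnrm n m S T α θ ≤ C) : Est n m S T α C θ := by
  unfold Xnrm at h
  simp only [iSup_le_iff, Subtype.forall] at h
  unfold nrm1A hol at h
  have k1 : ∀ t ∈ Icc (0:ℝ) T, ∀ ξ, nrm0 (max t S) T (fun s x => θ t s ξ x) ≤ C :=
    fun t ht ξ => le_trans (by simp only [add_assoc]; exact le_self_add) (h t ht ξ)
  have k2 : ∀ t ∈ Icc (0:ℝ) T, ∀ ξ, nrm0 (max t S) T (Dx fun s x => θ t s ξ x) ≤ C :=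
    fun t ht ξ => le_trans (by
      simp only [add_assoc]; exact le_add_left le_self_add) (h t ht ξ)
  have k3 : ∀ t ∈ Icc (0:ℝ) T, ∀ ξ, hS (max t S) T (α/2) (Dx fun s x => θ t s ξ x) ≤ C :=
    fun t ht ξ => le_trans (by
      simp only [add_assoc]; exact le_add_left (le_add_left le_self_add)) (h t ht ξ)
  have k4 : ∀ t ∈ Icc (0:ℝ) T, ∀ ξ, hX (max t S) T α (Dx fun s x => θ t s ξ x) ≤ C :=
    fun t ht ξ => le_trans (by
      simp only [add_assoc]
      exact le_add_left (le_add_left (le_add_left le_self_add))) (h t ht ξ)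
  have k5 : ∀ t ∈ Icc (0:ℝ) T, ∀ ξ, hS (max t S) T ((1+α)/2) (fun s x => θ t s ξ x) ≤ C :=
    fun t ht ξ => le_trans (by
      simp only [add_assoc]
      exact le_add_left (le_add_left (le_add_left (le_add_left le_self_add)))) (h t ht ξ)
  have k6 : ∀ t ∈ Icc (0:ℝ) T, ∀ ξ,
      nrm0 (max t S) T (fun s x => deriv (fun r => θ r s ξ x) t) ≤ C :=
    fun t ht ξ => le_trans (by
      rw [add_assoc, add_assoc, add_assoc]
      exact le_add_left le_self_add) (h t ht ξ)
  have k7 : ∀ t ∈ Icc (0:ℝ) T, ∀ ξ,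
      nrm0 (max t S) T (fun s x => fderiv ℝ (fun ξ' => θ t s ξ' x) ξ) ≤ C :=
    fun t ht ξ => le_trans (by
      rw [add_assoc, add_assoc, add_assoc]
      exact le_add_left (le_add_left le_self_add)) (h t ht ξ)
  exact {
    b0 := fun t ht s hs ξ x => nrm0_le_iff.1 (k1 t ht ξ) s hs x
    b1 := fun t ht s hs ξ x => nrm0_le_iff.1 (k2 t ht ξ) s hs x
    bt := fun t ht s hs ξ x => nrm0_le_iff.1 (k6 t ht ξ) s hs x
    bξ := fun t ht s hs ξ x => nrm0_le_iff.1 (k7 t ht ξ) s hs x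
    h0 := fun t ht s hs s' hs' ξ x =>
      (hS_le_iff (by linarith)).1 (k5 t ht ξ) s hs s' hs' x
    h1 := fun t ht s hs s' hs' ξ x =>
      (hS_le_iff (by linarith)).1 (k3 t ht ξ) s hs s' hs' x
    hx := fun t ht s hs ξ x w hd => (hX_le_iff hα).1 (k4 t ht ξ) s hs x w hd }

/-- the differentiability needed -/
def Dff (n m : ℕ) (S T : ℝ) (θ : ℝ → ℝ → En n → En n → En m) : Prop :=
  ∀ t ∈ Icc (0:ℝ) T, ∀ s ∈ Icc (max t S) T, ∀ ξ x : En n,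
    DifferentiableAt ℝ (fun y => θ t s ξ y) x ∧
    DifferentiableAt ℝ (fun r => θ r s ξ x) t ∧
    DifferentiableAt ℝ (fun ξ' => θ t s ξ' x) ξ

lemma diag_time {S T α C : ℝ} (hα : 0 < α) (hα1 : α < 1) (hT : 0 < T) (hS0 : 0 ≤ S)
    (hC : 0 ≤ C) {θ : ℝ → ℝ → En n → En n → En m} (hd : Dff n m S T θ) (he : Est n m S T α C θ)
    {s s' : ℝ} (hs : s ∈ Icc S T) (hs' : s' ∈ Icc S T) (x : En n) :
    ‖θ s s x x - θ s' s' x x‖ ≤ 2 * C * ((1 + T) * |s - s'| ^ (α / 2)) := by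
  wlog hle : s ≤ s' generalizing s s'
  · rw [norm_sub_rev, abs_sub_comm]
    exact this hs' hs (le_of_not_ge hle)
  have hst : s ∈ Icc (0:ℝ) T := ⟨hS0.trans hs.1, hs.2⟩
  have ha : |s - s'| ≤ T := by
    rw [abs_le]; constructor <;> linarith [hst.1, hs.2, hs'.1, hs'.2]
  have a1 := he.h0 s hst s ⟨max_le le_rfl hs.1, hs.2⟩ s' ⟨max_le hle hs'.1, hs'.2⟩ x x
  have a2 : ‖θ s s' x x - θ s' s' x x‖ ≤ C * ‖s - s'‖ := by
    refine Convex.norm_image_sub_le_of_norm_deriv_le (f := fun r => θ r s' x x)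
      (s := Icc s s') (fun r hr => ?_) (fun r hr => ?_) (convex_Icc _ _)
      (right_mem_Icc.2 hle) (left_mem_Icc.2 hle)
    · exact (hd r ⟨hst.1.trans hr.1, hr.2.trans hs'.2⟩ s' ⟨max_le hr.2 hs'.1, hs'.2⟩ x x).2.1
    · exact he.bt r ⟨hst.1.trans hr.1, hr.2.trans hs'.2⟩ s' ⟨max_le hr.2 hs'.1, hs'.2⟩ x x
  have c1 := rpow_cmp (γ := (1 + α) / 2) (β := α / 2) hT (abs_nonneg _) ha
    (by linarith) (by linarith) (by linarith)
  have c2 := rpow_cmp (γ := 1) (β := α / 2) hT (abs_nonneg _) ha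
    (by linarith) (by linarith) (by linarith)
  rw [Real.rpow_one] at c2
  rw [Real.norm_eq_abs] at a2
  have t := norm_sub_le_norm_sub_add_norm_sub (θ s s x x) (θ s s' x x) (θ s' s' x x)
  have d1 := mul_le_mul_of_nonneg_left c1 hC
  have d2 := mul_le_mul_of_nonneg_left c2 hC
  linarith

lemma le_rpow_of_le_one' {x α : ℝ} (hx : 0 ≤ x) (h1 : x ≤ 1) (hα1 : α < 1)
    (hα : 0 < α) : x ≤ x ^ α := by
  rcases hx.eq_or_lt with h | h
  · subst h; rw [Real.zero_rpow hα.ne']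
  · simpa using Real.rpow_le_rpow_of_exponent_ge h h1 hα1.le

lemma diag_space {S T α C : ℝ} (hα : 0 < α) (hα1 : α < 1) (hS0 : 0 ≤ S)
    (hC : 0 ≤ C) {θ : ℝ → ℝ → En n → En n → En m} (hd : Dff n m S T θ) (he : Est n m S T α C θ)
    {s : ℝ} (hs : s ∈ Icc S T) (x x' : En n) (hxx : dist x x' ≤ 1) :
    ‖θ s s x x - θ s s x' x'‖ ≤ 2 * C * dist x x' ^ α := by
  have hst : s ∈ Icc (0:ℝ) T := ⟨hS0.trans hs.1, hs.2⟩
  have hs2 : s ∈ Icc (max s S) T := ⟨max_le le_rfl hs.1, hs.2⟩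
  have a1 : ‖θ s s x x - θ s s x x'‖ ≤ C * ‖x - x'‖ :=
    Convex.norm_image_sub_le_of_norm_fderiv_le (𝕜 := ℝ) (f := fun y => θ s s x y)
      (s := univ) (fun r hr => (hd s hst s hs2 x r).1) (fun r hr => he.b1 s hst s hs2 x r)
      convex_univ (mem_univ _) (mem_univ _)
  have a2 : ‖θ s s x x' - θ s s x' x'‖ ≤ C * ‖x - x'‖ :=
    Convex.norm_image_sub_le_of_norm_fderiv_le (𝕜 := ℝ) (f := fun y => θ s s y x')
      (s := univ) (fun r hr => (hd s hst s hs2 r x').2.2) (fun r hr => he.bξ s hst s hs2 r x')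
      convex_univ (mem_univ _) (mem_univ _)
  rw [← dist_eq_norm x x'] at a1 a2
  have t := norm_sub_le_norm_sub_add_norm_sub (θ s s x x) (θ s s x x') (θ s s x' x')
  have d1 := mul_le_mul_of_nonneg_left (le_rpow_of_le_one' dist_nonneg hxx hα1 hα) hC
  linarith

lemma comp_diff {E F H : Type*} [NormedAddCommGroup E] [NormedSpace ℝ E]
    [NormedAddCommGroup F] [NormedSpace ℝ F] [NormedAddCommGroup H] [NormedSpace ℝ H]
    {P Q : F →L[ℝ] H} {a b : E →L[ℝ] F} {C L ρ B : ℝ} (hρ : 0 ≤ ρ) (hB : 1 ≤ B) (hC : 0 ≤ C)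
    (hL : 0 ≤ L) (hQ : ‖Q‖ ≤ C) (hPQ : ‖P - Q‖ ≤ C * ρ) (ha : ‖a‖ ≤ L)
    (hab : ‖a - b‖ ≤ L * (B * ρ)) : ‖P.comp a - Q.comp b‖ ≤ 2 * C * L * (B * ρ) := by
  have e : P.comp a - Q.comp b = (P - Q).comp a + Q.comp (a - b) := by
    ext x; simp
  rw [e]
  have h1 : ‖(P - Q).comp a‖ ≤ (C * ρ) * L :=
    (ContinuousLinearMap.opNorm_comp_le _ _).trans
      (mul_le_mul hPQ ha (norm_nonneg _) (by positivity))
  have h2 : ‖Q.comp (a - b)‖ ≤ C * (L * (B * ρ)) :=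
    (ContinuousLinearMap.opNorm_comp_le _ _).trans
      (mul_le_mul hQ hab (norm_nonneg _) hC)
  have h3 : ρ ≤ B * ρ := le_mul_of_one_le_left hρ hB
  have h4 := mul_le_mul_of_nonneg_left h3 (mul_nonneg hC hL)
  have := norm_add_le ((P - Q).comp a) (Q.comp (a - b))
  nlinarith

/-- two-point estimate for the generator -/
lemma two_point {X Y Z W : Type*} [NormedAddCommGroup X] [NormedSpace ℝ X]
    [NormedAddCommGroup Y] [NormedSpace ℝ Y] [NormedAddCommGroup Z] [NormedSpace ℝ Z]
    [NormedAddCommGroup W] [NormedSpace ℝ W]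
    {G : ℝ × ℝ × X × X × Y × (Z →L[ℝ] Y) → W} {L : ℝ} (hL : 0 < L)
    (hG : Differentiable ℝ G) (hb : ∀ p, ‖fderiv ℝ G p‖ ≤ L)
    (hl : ∀ p q, ‖fderiv ℝ G p - fderiv ℝ G q‖ ≤ L * ‖p - q‖)
    {M N B ρ : ℝ} (hM : 0 ≤ M) (hN : 0 ≤ N) (hB : 1 ≤ B) (hρ : 0 ≤ ρ)
    (t τ τ' : ℝ) (ξ η η' : X) (u u' v v' : Y) (P P' Q Q' : X →L[ℝ] Y) (a a' : Z →L[ℝ] X)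
    (hτ : |τ - τ'| ≤ B * ρ) (hη : ‖η - η'‖ ≤ B * ρ)
    (hu : ‖u - u'‖ ≤ 2 * M * (B * ρ)) (hv : ‖v - v'‖ ≤ 2 * M * (B * ρ))
    (huv : ‖(u - v) - (u' - v')‖ ≤ 2 * N * (B * ρ)) (hd : ‖u' - v'‖ ≤ N)
    (hP : ‖P'‖ ≤ M) (hQ : ‖Q'‖ ≤ M) (hPP : ‖P - P'‖ ≤ M * ρ) (hQQ : ‖Q - Q'‖ ≤ M * ρ)
    (hPQ : ‖P' - Q'‖ ≤ N) (hPQ' : ‖(P - Q) - (P' - Q')‖ ≤ N * ρ)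
    (ha : ‖a‖ ≤ L) (ha' : ‖a'‖ ≤ L) (haa : ‖a - a'‖ ≤ L * (B * ρ)) :
    ‖(G (t, τ, ξ, η, u, P.comp a) - G (t, τ, ξ, η, v, Q.comp a))
      - (G (t, τ', ξ, η', u', P'.comp a') - G (t, τ', ξ, η', v', Q'.comp a'))‖
      ≤ (L * (2 * B * (1 + L)) + L * (B * (1 + 2 * M * (1 + L))) * (1 + L)) * N * ρ := by
  have z1 := comp_diff hρ hB hM hL.le hP hPP ha haa
  have z2 := comp_diff hρ hB hM hL.le hQ hQQ ha haa
  have z3 := comp_diff hρ hB hN hL.le hPQ hPQ' ha haa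
  have z4 : ‖(P' - Q').comp a'‖ ≤ N * L := (ContinuousLinearMap.opNorm_comp_le _ _).trans
      (mul_le_mul hPQ ha' (norm_nonneg _) hN)
  rw [ContinuousLinearMap.sub_comp] at z4
  rw [ContinuousLinearMap.sub_comp, ContinuousLinearMap.sub_comp] at z3
  set R := B * ρ with hR
  have hR0 : 0 ≤ R := by positivity
  have p1 : 0 ≤ M * R := by positivity
  have p2 : 0 ≤ M * L * R := by positivity
  have p3 : 0 ≤ N * R := by positivity
  have p4 : 0 ≤ N * L * R := by positivity
  have p5 : 0 ≤ N * L := by positivity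
  have key := four_point hL.le hG hb hl (t, τ, ξ, η, u, P.comp a) (t, τ, ξ, η, v, Q.comp a)
    (t, τ', ξ, η', u', P'.comp a') (t, τ', ξ, η', v', Q'.comp a')
    (A := 2 * N * (1 + L) * R) (B := (1 + 2 * M * (1 + L)) * R) (D := N * (1 + L)) ?_ ?_ ?_ ?_
  · refine key.trans (le_of_eq ?_)
    rw [hR]; ring
  · simp only [Prod.mk_sub_mk, norm_prod_le_iff, sub_self, norm_zero]
    refine ⟨?_, ?_, ?_, ?_, ?_, ?_⟩ <;> linarith
  · simp only [Prod.mk_sub_mk, norm_prod_le_iff, sub_self, norm_zero, Real.norm_eq_abs]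
    refine ⟨?_, ?_, ?_, ?_, ?_, ?_⟩ <;> first | positivity | linarith
  · simp only [Prod.mk_sub_mk, norm_prod_le_iff, sub_self, norm_zero, Real.norm_eq_abs]
    refine ⟨?_, ?_, ?_, ?_, ?_, ?_⟩ <;> first | positivity | linarith
  · simp only [Prod.mk_sub_mk, norm_prod_le_iff, sub_self, norm_zero]
    refine ⟨?_, ?_, ?_, ?_, ?_, ?_⟩ <;> linarith

end helpers

/-- Lipschitz estimate, in the `X[S,T]`-norm, for the composed
generator, on the ball of radius `M`. -/
theorem stmt_7 (n m d : ℕ) (hn : 1 ≤ n) (hm : 1 ≤ m) (hd : 1 ≤ d)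
    (α T L : ℝ) (hα : 0 < α) (hα1 : α < 1) (hT : 0 < T) (hL : 0 < L)
    (M : ℝ≥0) (hM : 0 < M) :
    ∃ K : ℝ≥0,
      ∀ (g : ℝ → ℝ → En n → En n → En m → (En d →L[ℝ] En m) → En m)
        (σ : ℝ → En n → (En d →L[ℝ] En n)),
        (∀ (t s : ℝ) (ξ x : En n) (y : En m) (z : En d →L[ℝ] En m),
          ‖g t s ξ x y z‖ ≤ L) →
        ContDiff ℝ 1 (fun p : ℝ × ℝ × En n × En n × En m × (En d →L[ℝ] En m) =>
          g p.1 p.2.1 p.2.2.1 p.2.2.2.1 p.2.2.2.2.1 p.2.2.2.2.2) →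
        (∀ p : ℝ × ℝ × En n × En n × En m × (En d →L[ℝ] En m),
          ‖fderiv ℝ (fun q : ℝ × ℝ × En n × En n × En m × (En d →L[ℝ] En m) =>
              g q.1 q.2.1 q.2.2.1 q.2.2.2.1 q.2.2.2.2.1 q.2.2.2.2.2) p‖ ≤ L) →
        (∀ p q : ℝ × ℝ × En n × En n × En m × (En d →L[ℝ] En m),
          ‖fderiv ℝ (fun q' : ℝ × ℝ × En n × En n × En m × (En d →L[ℝ] En m) =>
                g q'.1 q'.2.1 q'.2.2.1 q'.2.2.2.1 q'.2.2.2.2.1 q'.2.2.2.2.2) p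
              - fderiv ℝ (fun q' : ℝ × ℝ × En n × En n × En m × (En d →L[ℝ] En m) =>
                g q'.1 q'.2.1 q'.2.2.1 q'.2.2.2.1 q'.2.2.2.2.1 q'.2.2.2.2.2) q‖
            ≤ L * ‖p - q‖) →
        (∀ (s : ℝ) (x : En n), ‖σ s x‖ ≤ L) →
        (∀ (s s' : ℝ) (x x' : En n), ‖σ s x - σ s' x'‖ ≤ L * (|s - s'| + ‖x - x'‖)) →
        ∀ S : ℝ, 0 ≤ S → S < T →
        ∀ θ θh : ℝ → ℝ → En n → En n → En m,
          memX n m S T α θ → memX n m S T α θh →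
          Xnrm n m S T α θ ≤ (M : ℝ≥0∞) → Xnrm n m S T α θh ≤ (M : ℝ≥0∞) →
        ∀ t ∈ Icc (0:ℝ) T, ∀ ξ : En n,
          nrmA (max t S) T α
            (fun τ η =>
              g t τ ξ η (θ τ τ η η) ((fderiv ℝ (fun y => θ t τ ξ y) η).comp (σ τ η))
              - g t τ ξ η (θh τ τ η η)
                  ((fderiv ℝ (fun y => θh t τ ξ y) η).comp (σ τ η)))
            ≤ (K : ℝ≥0∞) * Xnrm n m S T α (fun t' s' ξ' x' => θ t' s' ξ' x' - θh t' s' ξ' x') := by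
  set K0 : ℝ := L * (2 * (1 + T) * (1 + L))
    + L * ((1 + T) * (1 + 2 * (M:ℝ) * (1 + L))) * (1 + L) with hK0
  have hMr : (0:ℝ) < M := hM
  have hK0p : 0 < K0 := by positivity
  set k0 : ℝ≥0 := ⟨K0, hK0p.le⟩ with hk0
  set k1 : ℝ≥0 := ⟨L * (1 + L), by positivity⟩ with hk1
  refine ⟨k1 + (k0 + k0), ?_⟩
  intro g σ _ hgc hgb hgl hσb hσl S hS0 hST θ θh hθ hθh hθM hθhM t ht ξ
  set δ : ℝ → ℝ → En n → En n → En m := fun t' s' ξ' x' => θ t' s' ξ' x' - θh t' s' ξ' x' with hδ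
  set G : ℝ × ℝ × En n × En n × En m × (En d →L[ℝ] En m) → En m := fun p =>
    g p.1 p.2.1 p.2.2.1 p.2.2.2.1 p.2.2.2.2.1 p.2.2.2.2.2 with hGdef
  by_cases hN : Xnrm n m S T α δ = ⊤
  · rw [hN, ENNReal.mul_top]
    · exact le_top
    · rw [ENNReal.coe_ne_zero]
      have : 0 < k0 := hK0p
      positivity
  lift Xnrm n m S T α δ to ℝ≥0 using hN with N hNe
  have eθ := est_of_Xnrm hα hθM
  have eθh := est_of_Xnrm hα hθhM
  have eδ := est_of_Xnrm hα hNe.symm.le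
  have dθ : Dff n m S T θ := fun t ht s hs ξ x =>
    let h := hθ.1 t ht s hs ξ x; ⟨h.1, h.2.1, h.2.2.1⟩
  have dθh : Dff n m S T θh := fun t ht s hs ξ x =>
    let h := hθh.1 t ht s hs ξ x; ⟨h.1, h.2.1, h.2.2.1⟩
  have dδ : Dff n m S T δ := fun t ht s hs ξ x =>
    let h := dθ t ht s hs ξ x
    let h' := dθh t ht s hs ξ x
    ⟨h.1.sub h'.1, h.2.1.sub h'.2.1, h.2.2.sub h'.2.2⟩
  have fδ : ∀ s ∈ Icc (max t S) T, ∀ x, fderiv ℝ (fun y => δ t s ξ y) x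
      = fderiv ℝ (fun y => θ t s ξ y) x - fderiv ℝ (fun y => θh t s ξ y) x := fun s hs x =>
    fderiv_fun_sub (dθ t ht s hs ξ x).1 (dθh t ht s hs ξ x).1
  have hGd : Differentiable ℝ G := hgc.differentiable (by norm_num)
  have hsub : ∀ s ∈ Icc (max t S) T, s ∈ Icc S T := fun s hs => ⟨(le_max_right _ _).trans hs.1, hs.2⟩
  have hdiag : ∀ s ∈ Icc (max t S) T, s ∈ Icc (0:ℝ) T ∧ s ∈ Icc (max s S) T := fun s hs =>
    have h := hsub s hs
    ⟨⟨hS0.trans h.1, h.2⟩, ⟨max_le le_rfl h.1, h.2⟩⟩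
  have bd : ∀ s ∈ Icc (max t S) T, ∀ x, ‖θ s s x x - θh s s x x‖ ≤ N := fun s hs x =>
    eδ.b0 s (hdiag s hs).1 s (hdiag s hs).2 x x
  have bP : ∀ s ∈ Icc (max t S) T, ∀ x,
      ‖fderiv ℝ (fun y => θ t s ξ y) x - fderiv ℝ (fun y => θh t s ξ y) x‖ ≤ N := fun s hs x => by
    rw [← fδ s hs x]; exact eδ.b1 t ht s hs ξ x
  have hNr : (0:ℝ) ≤ N := N.2
  have hB : 1 ≤ 1 + T := by linarith
  unfold nrmA hol
  rw [ENNReal.coe_add, ENNReal.coe_add, add_mul, add_mul, ← ENNReal.coe_mul, ← ENNReal.coe_mul]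
  refine add_le_add ?_ (add_le_add ?_ ?_)
  · rw [nrm0_le_iff]
    intro s hs x
    have h := Convex.norm_image_sub_le_of_norm_fderiv_le (𝕜 := ℝ) (f := G) (s := univ) (C := L)
      (fun r _ => hGd r) (fun r _ => hgb r) convex_univ
      (mem_univ (t, s, ξ, x, θh s s x x, (fderiv ℝ (fun y => θh t s ξ y) x).comp (σ s x)))
      (mem_univ (t, s, ξ, x, θ s s x x, (fderiv ℝ (fun y => θ t s ξ y) x).comp (σ s x)))
    refine h.trans ?_
    have e : ((k1 * N : ℝ≥0) : ℝ) = L * ((1 + L) * N) := by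
      have e1 : (k1 : ℝ) = L * (1 + L) := rfl
      rw [NNReal.coe_mul, e1]; ring
    rw [e]
    refine mul_le_mul_of_nonneg_left ?_ hL.le
    have z4 : ‖(fderiv ℝ (fun y => θ t s ξ y) x - fderiv ℝ (fun y => θh t s ξ y) x).comp (σ s x)‖
        ≤ N * L := (ContinuousLinearMap.opNorm_comp_le _ _).trans
      (mul_le_mul (bP s hs x) (hσb _ _) (norm_nonneg _) hNr)
    rw [ContinuousLinearMap.sub_comp] at z4
    have z5 := bd s hs x
    have p5 : 0 ≤ N * L := by positivity
    simp only [Prod.mk_sub_mk, norm_prod_le_iff, sub_self, norm_zero]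
    refine ⟨?_, ?_, ?_, ?_, ?_, ?_⟩ <;> linarith
  · rw [hS_le_iff (by linarith)]
    intro s hs s' hs' x
    have ha : |s - s'| ≤ T := by
      have h1 := (hdiag s hs).1
      have h2 := (hdiag s' hs').1
      rw [abs_le]; constructor <;> linarith [h1.1, h1.2, h2.1, h2.2]
    have c2 := rpow_cmp (γ := 1) (β := α / 2) hT (abs_nonneg _) ha
      (by linarith) (by linarith) (by linarith)
    rw [Real.rpow_one] at c2
    have hρ : 0 ≤ |s - s'| ^ (α / 2) := by positivity
    refine two_point hL hGd hgb hgl hMr.le hNr hB hρ t s s' ξ x x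
      (θ s s x x) (θ s' s' x x) (θh s s x x) (θh s' s' x x)
      (fderiv ℝ (fun y => θ t s ξ y) x) (fderiv ℝ (fun y => θ t s' ξ y) x)
      (fderiv ℝ (fun y => θh t s ξ y) x) (fderiv ℝ (fun y => θh t s' ξ y) x)
      (σ s x) (σ s' x) c2 ?_
      (diag_time hα hα1 hT hS0 hMr.le dθ eθ (hsub s hs) (hsub s' hs') x)
      (diag_time hα hα1 hT hS0 hMr.le dθh eθh (hsub s hs) (hsub s' hs') x)
      (diag_time hα hα1 hT hS0 hNr dδ eδ (hsub s hs) (hsub s' hs') x)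
      (bd s' hs' x) (eθ.b1 t ht s' hs' ξ x) (eθh.b1 t ht s' hs' ξ x)
      (eθ.h1 t ht s hs s' hs' ξ x) (eθh.h1 t ht s hs s' hs' ξ x)
      (bP s' hs' x) ?_ (hσb _ _) (hσb _ _) ?_
    · rw [sub_self, norm_zero]; positivity
    · rw [← fδ s hs x, ← fδ s' hs' x]
      exact eδ.h1 t ht s hs s' hs' ξ x
    · refine (hσl _ _ _ _).trans ?_
      rw [sub_self, norm_zero, add_zero]
      exact mul_le_mul_of_nonneg_left c2 hL.le
  · rw [hX_le_iff hα]
    intro s hs x x' hxx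
    have c1 := le_rpow_of_le_one' dist_nonneg hxx hα1 hα
    have hρ : 0 ≤ dist x x' ^ α := by positivity
    have c3 : dist x x' ^ α ≤ (1 + T) * dist x x' ^ α := le_mul_of_one_le_left hρ hB
    have c2 : ‖x - x'‖ ≤ (1 + T) * dist x x' ^ α := by
      rw [← dist_eq_norm]; exact c1.trans c3
    refine two_point hL hGd hgb hgl hMr.le hNr hB hρ t s s ξ x x'
      (θ s s x x) (θ s s x' x') (θh s s x x) (θh s s x' x')
      (fderiv ℝ (fun y => θ t s ξ y) x) (fderiv ℝ (fun y => θ t s ξ y) x')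
      (fderiv ℝ (fun y => θh t s ξ y) x) (fderiv ℝ (fun y => θh t s ξ y) x')
      (σ s x) (σ s x') ?_ c2
      ((diag_space hα hα1 hS0 hMr.le dθ eθ (hsub s hs) x x' hxx).trans
        (mul_le_mul_of_nonneg_left c3 (by positivity)))
      ((diag_space hα hα1 hS0 hMr.le dθh eθh (hsub s hs) x x' hxx).trans
        (mul_le_mul_of_nonneg_left c3 (by positivity)))
      ((diag_space hα hα1 hS0 hNr dδ eδ (hsub s hs) x x' hxx).trans
        (mul_le_mul_of_nonneg_left c3 (by positivity)))
      (bd s hs x') (eθ.b1 t ht s hs ξ x') (eθh.b1 t ht s hs ξ x')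
      (eθ.hx t ht s hs ξ x x' hxx) (eθh.hx t ht s hs ξ x x' hxx)
      (bP s hs x') ?_ (hσb _ _) (hσb _ _) ?_
    · rw [sub_self, abs_zero]; positivity
    · rw [← fδ s hs x, ← fδ s hs x']
      exact eδ.hx t ht s hs ξ x x' hxx
    · refine (hσl _ _ _ _).trans ?_
      rw [sub_self, abs_zero, zero_add]
      exact mul_le_mul_of_nonneg_left c2 hL.le

end
end

section
/- Fix 1 < p < 2. Under the kernel hypotheses on G and the hypotheses on g and σ, there is δ > 0, depending only on n, K₀, λ, L, p and T, such that whenever T − S ≤ δ there exists a unique θ ∈ Y[S,T] satisfying θ = S[θ], i.e., a unique solution in Y[S,T] of the nonlinear integral equation θ(t,s,ξ,x) = ∫_s^T ∫_{ℝ^n} G(s,x;τ,η) g( t, τ, ξ, η, θ(τ,τ,η,η), θ_η(t,τ,ξ,η)σ(τ,η), [ ∫_{ℝ^n} ∂_ξ G(t,ξ;τ,η̄) θ(τ,τ,η̄,η̄) dη̄ ] σ(τ,η) ) dη dτ for all (t,s) ∈ Δ̂[S,T] and ξ, x ∈ ℝ^n. (This integral equation characterizes the mild solutions of the coupled representation PDE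 system for Type-II backward stochastic Volterra integral equations, where G is the fundamental solution of the underlying parabolic operator.) -/
open scoped ENNReal NNReal BigOperators
open Set

noncomputable section

variable {n m : ℕ}

/-- the `Y[S,T]`-norm (with exponent `p`). -/
def Ynrm (n m : ℕ) (S T p : ℝ) (θ : ℝ → ℝ → En n → En n → En m) : ℝ≥0∞ :=
  (⨆ t : Icc (0:ℝ) T,
    (∫⁻ s in Ioc (max t.1 S) T,
        (⨆ (ξ : En n) (x : En n),
          (‖fderiv ℝ (fun y => θ t.1 s ξ y) x‖₊ : ℝ≥0∞)) ^ p) ^ (1/p))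
  + ⨆ (t : Icc (0:ℝ) T) (s : Icc (max t.1 S) T) (ξ : En n) (x : En n),
      (‖θ t.1 s.1 ξ x‖₊ : ℝ≥0∞)

/-- membership in `Y[S,T]`. -/
def memY (n m : ℕ) (S T p : ℝ) (θ : ℝ → ℝ → En n → En n → En m) : Prop :=
  Measurable (fun q : ℝ × ℝ × En n × En n => θ q.1 q.2.1 q.2.2.1 q.2.2.2) ∧
  (∀ t ∈ Icc (0:ℝ) T, ∀ s ∈ Icc (max t S) T, ∀ ξ x : En n,
    DifferentiableAt ℝ (fun y => θ t s ξ y) x) ∧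
  Ynrm n m S T p θ ≠ ⊤

/-- hypotheses on the kernel `G`: measurability, differentiability in the second
(space) variable, and Gaussian bounds on `G` and its spatial gradient. -/
def KernelHyp (n : ℕ) (T K0 lam : ℝ) (G : ℝ → En n → ℝ → En n → ℝ) : Prop :=
  Measurable (fun q : ℝ × En n × ℝ × En n => G q.1 q.2.1 q.2.2.1 q.2.2.2) ∧
  (∀ (s : ℝ) (x : En n) (τ : ℝ) (η : En n), 0 ≤ s → s < τ → τ ≤ T →
    DifferentiableAt ℝ (fun y => G s y τ η) x) ∧
  (∀ (s : ℝ) (x : En n) (τ : ℝ) (η : En n), 0 ≤ s → s < τ → τ ≤ T →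
    |G s x τ η|
      ≤ K0 * (τ - s) ^ (-(n : ℝ)/2) * Real.exp (-lam * ‖η - x‖^2 / (τ - s))) ∧
  (∀ (s : ℝ) (x : En n) (τ : ℝ) (η : En n), 0 ≤ s → s < τ → τ ≤ T →
    ‖fderiv ℝ (fun y => G s y τ η) x‖
      ≤ K0 * (τ - s) ^ (-((n : ℝ) + 1)/2) * Real.exp (-lam * ‖η - x‖^2 / (τ - s)))

/-- hypotheses on `g` and `σ`: measurability, boundedness by `L`, and Lipschitz
continuity of `g` in its last three arguments with constant `L`. -/
def GSHyp (n m d : ℕ) (L : ℝ)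
    (g : ℝ → ℝ → En n → En n → En m → (En d →L[ℝ] En m) → (En d →L[ℝ] En m) → En m)
    (σ : ℝ → En n → (En d →L[ℝ] En n)) : Prop :=
  Measurable (fun q : ℝ × ℝ × En n × En n × En m ×
      (En d →L[ℝ] En m) × (En d →L[ℝ] En m) =>
    g q.1 q.2.1 q.2.2.1 q.2.2.2.1 q.2.2.2.2.1 q.2.2.2.2.2.1 q.2.2.2.2.2.2) ∧
  (∀ (t s : ℝ) (ξ x : En n) (y : En m) (z ζ : En d →L[ℝ] En m),
    ‖g t s ξ x y z ζ‖ ≤ L) ∧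
  (∀ (t s : ℝ) (ξ x : En n) (y y' : En m) (z z' ζ ζ' : En d →L[ℝ] En m),
    ‖g t s ξ x y z ζ - g t s ξ x y' z' ζ'‖
      ≤ L * (‖y - y'‖ + ‖z - z'‖ + ‖ζ - ζ'‖)) ∧
  Measurable (fun p : ℝ × En n => σ p.1 p.2) ∧
  (∀ (s : ℝ) (x : En n), ‖σ s x‖ ≤ L)

/-- the nonlinear integral operator `S` associated with the mild form of the coupled
representation PDE system for Type-II BSVIEs. -/
def Smap (n m d : ℕ) (T : ℝ) (G : ℝ → En n → ℝ → En n → ℝ)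
    (g : ℝ → ℝ → En n → En n → En m → (En d →L[ℝ] En m) → (En d →L[ℝ] En m) → En m)
    (σ : ℝ → En n → (En d →L[ℝ] En n))
    (θ : ℝ → ℝ → En n → En n → En m) : ℝ → ℝ → En n → En n → En m :=
  fun t s ξ x =>
    ∫ τ in Ioc s T, ∫ η : En n,
      G s x τ η •
        g t τ ξ η (θ τ τ η η)
          ((fderiv ℝ (fun y => θ t τ ξ y) η).comp (σ τ η))
          ((∫ ηb : En n,
              (fderiv ℝ (fun ξ' => G t ξ' τ ηb) ξ).smulRight (θ τ τ ηb ηb)).comp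
            (σ τ η))

open MeasureTheory Filter Topology

theorem aux_meas_comp {α : Type*} [MeasurableSpace α] {n m d : ℕ}
    {f : α → En n →L[ℝ] En m} {g : α → En d →L[ℝ] En n}
    (hf : Measurable f) (hg : Measurable g) : Measurable (fun p => (f p).comp (g p)) := by
  have h : Continuous (fun p : (En n →L[ℝ] En m) × (En d →L[ℝ] En n) => p.1.comp p.2) := by
    fun_prop
  exact h.measurable.comp (hf.prodMk hg)

theorem aux_meas_smulRight {α : Type*} [MeasurableSpace α] {n m : ℕ}
    {f : α → En n →L[ℝ] ℝ} {g : α → En m}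
    (hf : Measurable f) (hg : Measurable g) : Measurable (fun p => (f p).smulRight (g p)) := by
  have h : Continuous (fun p : (En n →L[ℝ] ℝ) × En m => p.1.smulRight p.2) := by
    fun_prop
  exact h.measurable.comp (hf.prodMk hg)

theorem aux_mset3 {α : Type*} [MeasurableSpace α] {e f g h : α → ℝ} (he : Measurable e)
    (hf : Measurable f) (hg : Measurable g) (hh : Measurable h) :
    MeasurableSet {p : α | e p ≤ f p ∧ f p < g p ∧ g p ≤ h p} :=
  (measurableSet_le he hf).inter ((measurableSet_lt hf hg).inter (measurableSet_le hg hh))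

theorem aux_meas_fderiv {α : Type*} [MeasurableSpace α] {n : ℕ} {V : Type*}
    [NormedAddCommGroup V] [NormedSpace ℝ V] [FiniteDimensional ℝ V]
    [MeasurableSpace V] [BorelSpace V]
    (f : α → En n → V) (hf : Measurable (fun p : α × En n => f p.1 p.2))
    (A : Set (α × En n)) (hA : MeasurableSet A)
    (hd : ∀ p ∈ A, DifferentiableAt ℝ (f p.1) p.2) :
    Measurable (A.indicator (fun p => fderiv ℝ (f p.1) p.2)) := by
  have : ProperSpace V := FiniteDimensional.proper ℝ V
  have hdir : ∀ v : En n, Measurable (A.indicator (fun p => fderiv ℝ (f p.1) p.2 v)) := by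
    intro v
    refine measurable_of_tendsto_metrizable
      (f := fun (k : ℕ) => A.indicator (fun p : α × En n =>
        (k : ℝ) • (f p.1 (p.2 + (k : ℝ)⁻¹ • v) - f p.1 p.2))) (fun k => ?_) ?_
    · refine Measurable.indicator ?_ hA
      refine Measurable.const_smul (Measurable.sub ?_ hf) (k : ℝ)
      exact hf.comp (f := fun p : α × En n => (p.1, p.2 + (k : ℝ)⁻¹ • v)) (by fun_prop)
    · rw [tendsto_pi_nhds]
      intro p
      by_cases hp : p ∈ A
      · simp only [Set.indicator_of_mem hp]
        exact ((hd p hp).hasFDerivAt.lim_real v).comp tendsto_natCast_atTop_atTop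
      · simp only [Set.indicator_of_notMem hp]
        exact tendsto_const_nhds
  have hc : ∀ i : Fin n, Measurable (fun y : V =>
      (EuclideanSpace.proj i : En n →L[ℝ] ℝ).smulRight y) := by
    intro i
    have : Continuous (fun y : V => (EuclideanSpace.proj i : En n →L[ℝ] ℝ).smulRight y) := by
      fun_prop
    exact this.measurable
  have hsum : (A.indicator (fun p => fderiv ℝ (f p.1) p.2)) = fun p => ∑ i : Fin n,
      (EuclideanSpace.proj i : En n →L[ℝ] ℝ).smulRight
        (A.indicator (fun p => fderiv ℝ (f p.1) p.2 (EuclideanSpace.single i (1:ℝ))) p) := by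
    funext p
    by_cases hp : p ∈ A
    · simp only [Set.indicator_of_mem hp]
      ext1 v
      have hv : v = ∑ i, v i • EuclideanSpace.single i (1:ℝ) := by
        ext j
        simp [Finset.sum_apply, Pi.single_apply]
      conv_lhs => rw [hv]
      simp [map_sum]
    · simp [Set.indicator_of_notMem hp]
  rw [hsum]
  exact Finset.measurable_sum _ fun i _ => (hc i).comp (hdir _)

theorem aux_gauss {n : ℕ} {V : Type*} [NormedAddCommGroup V] [NormedSpace ℝ V]
    {lam r a : ℝ} (hlam : 0 < lam) (hr : 0 < r) (x : En n) (k : En n → V)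
    (hk : AEStronglyMeasurable k volume)
    (hb : ∀ η, ‖k η‖ ≤ a * r ^ (-(n : ℝ)/2) * Real.exp (-lam * ‖η - x‖^2 / r)) :
    Integrable k ∧ ‖∫ η, k η‖ ≤ a * (Real.pi / lam) ^ ((n : ℝ)/2) := by
  have hl : 0 < lam / r := div_pos hlam hr
  have h0 : Integrable (fun v : En n => Real.exp (-(lam / r) * ‖v‖^2)) := by
    have := (GaussianFourier.integrable_cexp_neg_mul_sq_norm_add (b := ((lam / r : ℝ) : ℂ))
      (V := En n) (by simpa using hl) 0 0).re
    refine this.congr (ae_of_all _ fun v => ?_)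
    simp only [zero_mul, add_zero]
    have : (-((lam / r : ℝ) : ℂ) * (‖v‖ : ℂ) ^ 2) = ((-(lam / r) * ‖v‖ ^ 2 : ℝ) : ℂ) := by
      push_cast; ring
    rw [this, ← Complex.ofReal_exp]; rfl
  have h1 : Integrable (fun v : En n => Real.exp (-(lam / r) * ‖v - x‖^2)) := h0.comp_sub_right x
  have h2 := h1.const_mul (a * r ^ (-(n : ℝ)/2))
  have hb' : ∀ η, ‖k η‖ ≤ a * r ^ (-(n : ℝ)/2) * Real.exp (-(lam / r) * ‖η - x‖^2) := by
    intro η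
    have := hb η
    rwa [show -lam * ‖η - x‖^2 / r = -(lam / r) * ‖η - x‖^2 by ring] at this
  refine ⟨h2.mono' hk (ae_of_all _ hb'), ?_⟩
  refine (norm_integral_le_of_norm_le h2 (ae_of_all _ hb')).trans ?_
  rw [integral_const_mul, integral_sub_right_eq_self (fun v : En n => Real.exp (-(lam / r) * ‖v‖^2)) x,
    GaussianFourier.integral_rexp_neg_mul_sq_norm hl]
  have hfr : ((Module.finrank ℝ (En n) : ℕ) : ℝ) = n := by simp
  rw [hfr]
  have : (Real.pi / (lam / r)) = (Real.pi / lam) * r := by field_simp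
  rw [this, Real.mul_rpow (by positivity) hr.le, show -(n:ℝ)/2 = -((n:ℝ)/2) by ring, Real.rpow_neg hr.le]
  have : r ^ ((n:ℝ)/2) ≠ 0 := by positivity
  apply le_of_eq; field_simp

theorem aux_time {V : Type*} [NormedAddCommGroup V] [NormedSpace ℝ V]
    {s T a γ : ℝ} (hγ : γ < 1) (hsT : s ≤ T) (f : ℝ → V)
    (hf : AEStronglyMeasurable f (volume.restrict (Ioc s T)))
    (hb : ∀ τ ∈ Ioc s T, ‖f τ‖ ≤ a * (τ - s) ^ (-γ)) :
    IntegrableOn f (Ioc s T) ∧ ‖∫ τ in Ioc s T, f τ‖ ≤ a * ((T - s) ^ (1 - γ) / (1 - γ)) := by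
  have h1 : IntervalIntegrable (fun τ : ℝ => (τ - s) ^ (-γ)) volume s T := by
    have := (intervalIntegral.intervalIntegrable_rpow' (a := 0) (b := T - s) (r := -γ)
      (by linarith)).comp_sub_right s
    simpa using this
  have h2 : IntegrableOn (fun τ : ℝ => a * (τ - s) ^ (-γ)) (Ioc s T) :=
    ((intervalIntegrable_iff_integrableOn_Ioc_of_le hsT).1 h1).const_mul a
  have hb' : ∀ᵐ τ ∂(volume.restrict (Ioc s T)), ‖f τ‖ ≤ a * (τ - s) ^ (-γ) :=
    (ae_restrict_iff' measurableSet_Ioc).2 (ae_of_all _ hb)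
  refine ⟨h2.mono' hf hb', (norm_integral_le_of_norm_le h2 hb').trans (le_of_eq ?_)⟩
  rw [integral_const_mul, ← intervalIntegral.integral_of_le hsT,
    intervalIntegral.integral_comp_sub_right (fun y => y ^ (-γ)) s, integral_rpow (by left; linarith)]
  rw [sub_self, Real.zero_rpow (by linarith), show -γ + 1 = 1 - γ by ring, sub_zero]

def DG {n : ℕ} (T : ℝ) (G : ℝ → En n → ℝ → En n → ℝ) (s : ℝ) (x : En n) (τ : ℝ) (η : En n) :
    En n →L[ℝ] ℝ :=
  {q : ℝ × ℝ | 0 ≤ q.1 ∧ q.1 < q.2 ∧ q.2 ≤ T}.indicator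
    (fun _ => fderiv ℝ (fun y => G s y τ η) x) (s, τ)

theorem DG_eq {n : ℕ} {T : ℝ} (G : ℝ → En n → ℝ → En n → ℝ) {s : ℝ} (x : En n) {τ : ℝ} (η : En n)
    (h0 : 0 ≤ s) (h1 : s < τ) (h2 : τ ≤ T) :
    DG T G s x τ η = fderiv ℝ (fun y => G s y τ η) x := by
  unfold DG; rw [Set.indicator_of_mem]; exact ⟨h0, h1, h2⟩

theorem DG_meas {n : ℕ} {T K0 lam : ℝ} {G : ℝ → En n → ℝ → En n → ℝ}
    (hG : KernelHyp n T K0 lam G) :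
    Measurable (fun q : ℝ × En n × ℝ × En n => DG T G q.1 q.2.1 q.2.2.1 q.2.2.2) := by
  have h := aux_meas_fderiv (α := ℝ × ℝ × En n) (fun a y => G a.1 y a.2.1 a.2.2)
    (by exact hG.1.comp (g := fun q : ℝ × En n × ℝ × En n => G q.1 q.2.1 q.2.2.1 q.2.2.2)
          (f := fun p : (ℝ × ℝ × En n) × En n => (p.1.1, p.2, p.1.2.1, p.1.2.2)) (by fun_prop))
    {p | 0 ≤ p.1.1 ∧ p.1.1 < p.1.2.1 ∧ p.1.2.1 ≤ T}
    (aux_mset3 measurable_const (by fun_prop) (by fun_prop) measurable_const)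
    (fun p hp => hG.2.1 _ _ _ _ hp.1 hp.2.1 hp.2.2)
  exact h.comp (f := fun q : ℝ × En n × ℝ × En n => ((q.1, q.2.2.1, q.2.2.2), q.2.1)) (by fun_prop)

/-- spatial estimates. -/
theorem aux_G {n m : ℕ} {T K0 lam : ℝ} {G : ℝ → En n → ℝ → En n → ℝ} (hlam : 0 < lam)
    (hG : KernelHyp n T K0 lam G) {s τ c : ℝ} (x : En n) (h0 : 0 ≤ s) (h1 : s < τ) (h2 : τ ≤ T)
    (H : En n → En m) (hH : Measurable H) (hc : ∀ η, ‖H η‖ ≤ c) :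
    Integrable (fun η => G s x τ η • H η) ∧
      ‖∫ η, G s x τ η • H η‖ ≤ K0 * (Real.pi / lam) ^ ((n : ℝ)/2) * c := by
  have hm : Measurable (fun η => G s x τ η) :=
    hG.1.comp (g := fun q : ℝ × En n × ℝ × En n => G q.1 q.2.1 q.2.2.1 q.2.2.2)
      (f := fun η => (s, x, τ, η)) (by fun_prop)
  have := aux_gauss (a := K0 * c) hlam (sub_pos.2 h1) x (fun η => G s x τ η • H η)
    (hm.smul hH).aestronglyMeasurable (fun η => by
      rw [norm_smul, Real.norm_eq_abs]
      have e := hG.2.2.1 s x τ η h0 h1 h2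
      calc _ ≤ (K0 * (τ - s) ^ (-(n : ℝ)/2) * Real.exp (-lam * ‖η - x‖^2 / (τ - s))) * c :=
            mul_le_mul e (hc η) (norm_nonneg _) ((abs_nonneg _).trans e)
        _ = _ := by ring)
  refine ⟨this.1, this.2.trans (le_of_eq (by ring))⟩

theorem aux_DG {n m : ℕ} {T K0 lam : ℝ} {G : ℝ → En n → ℝ → En n → ℝ} (hlam : 0 < lam)
    (hG : KernelHyp n T K0 lam G) {s τ c : ℝ} (x : En n) (h0 : 0 ≤ s) (h1 : s < τ) (h2 : τ ≤ T)
    (H : En n → En m) (hH : Measurable H) (hc : ∀ η, ‖H η‖ ≤ c) :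
    Integrable (fun η => (DG T G s x τ η).smulRight (H η)) ∧
      ‖∫ η, (DG T G s x τ η).smulRight (H η)‖ ≤
        K0 * (Real.pi / lam) ^ ((n : ℝ)/2) * c * (τ - s) ^ (-(1/2) : ℝ) := by
  have hm : Measurable (fun η => DG T G s x τ η) :=
    (DG_meas hG).comp (f := fun η => (s, x, τ, η)) (by fun_prop)
  have := aux_gauss (a := K0 * c * (τ - s) ^ (-(1/2) : ℝ)) hlam (sub_pos.2 h1) x
    (fun η => (DG T G s x τ η).smulRight (H η))
    (aux_meas_smulRight hm hH).aestronglyMeasurable (fun η => by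
      rw [ContinuousLinearMap.norm_smulRight_apply]
      have e := hG.2.2.2 s x τ η h0 h1 h2
      rw [← DG_eq G x η h0 h1 h2] at e
      calc _ ≤ (K0 * (τ - s) ^ (-((n : ℝ) + 1)/2) * Real.exp (-lam * ‖η - x‖^2 / (τ - s))) * c :=
            mul_le_mul e (hc η) (norm_nonneg _) ((norm_nonneg _).trans e)
        _ = _ := by
          rw [show -((n : ℝ) + 1)/2 = (-(1/2) : ℝ) + -(n:ℝ)/2 by ring, Real.rpow_add (sub_pos.2 h1)]
          ring)
  refine ⟨this.1, this.2.trans (le_of_eq (by ring))⟩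

theorem aux_diff_inner {n m : ℕ} {T K0 lam : ℝ} {G : ℝ → En n → ℝ → En n → ℝ} (hlam : 0 < lam)
    (hK0 : 0 < K0)
    (hG : KernelHyp n T K0 lam G) {s τ c : ℝ} (x : En n) (h0 : 0 ≤ s) (h1 : s < τ) (h2 : τ ≤ T)
    (H : En n → En m) (hH : Measurable H) (hc : ∀ η, ‖H η‖ ≤ c) :
    HasFDerivAt (fun y => ∫ η, G s y τ η • H η) (∫ η, (DG T G s x τ η).smulRight (H η)) x := by
  have hr : 0 < τ - s := sub_pos.2 h1
  have hc0 : 0 ≤ c := (norm_nonneg _).trans (hc 0)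
  have hm : ∀ y, Measurable (fun η => G s y τ η) := fun y =>
    hG.1.comp (g := fun q : ℝ × En n × ℝ × En n => G q.1 q.2.1 q.2.2.1 q.2.2.2)
      (f := fun η => (s, y, τ, η)) (by fun_prop)
  set r := τ - s with hrdef
  refine hasFDerivAt_integral_of_dominated_of_fderiv_le (𝕜 := ℝ)
    (F := fun y η => G s y τ η • H η) (F' := fun y η => (DG T G s y τ η).smulRight (H η))
    (bound := fun η => (K0 * c * Real.exp (lam / r) * r ^ (-(1/2) : ℝ)) * r ^ (-(n:ℝ)/2) *
      Real.exp (-(lam/2) * ‖η - x‖^2 / r))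
    (Metric.ball_mem_nhds x one_pos) ?_ (aux_G hlam hG x h0 h1 h2 H hH hc).1
    (aux_DG hlam hG x h0 h1 h2 H hH hc).1.aestronglyMeasurable ?_ ?_ ?_
  · exact Eventually.of_forall fun y => ((hm y).smul hH).aestronglyMeasurable
  · refine ae_of_all _ fun η y hy => ?_
    rw [ContinuousLinearMap.norm_smulRight_apply]
    have e := hG.2.2.2 s y τ η h0 h1 h2
    rw [← DG_eq G y η h0 h1 h2] at e
    have e2 : Real.exp (-lam * ‖η - y‖^2 / r) ≤
        Real.exp (lam / r) * Real.exp (-(lam/2) * ‖η - x‖^2 / r) := by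
      rw [← Real.exp_add, Real.exp_le_exp]
      have hy' : ‖y - x‖ ≤ 1 := by
        rw [← dist_eq_norm]; exact (Metric.mem_ball.1 hy).le
      have tri : ‖η - x‖ ≤ ‖η - y‖ + ‖y - x‖ := by
        have := norm_add_le (η - y) (y - x); simpa using this
      have hsq : ‖η - x‖^2 ≤ 2 * ‖η - y‖^2 + 2 := by
        have h3 : ‖η - x‖ ≤ ‖η - y‖ + 1 := by linarith
        have := norm_nonneg (η - x)
        nlinarith [sq_nonneg (‖η - y‖ - 1), norm_nonneg (η - y)]
      rw [← add_div]
      apply div_le_div_of_nonneg_right _ hr.le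
      nlinarith
    calc _ ≤ (K0 * r ^ (-((n : ℝ) + 1)/2) * Real.exp (-lam * ‖η - y‖^2 / r)) * c :=
          mul_le_mul e (hc η) (norm_nonneg _) ((norm_nonneg _).trans e)
      _ ≤ (K0 * r ^ (-((n : ℝ) + 1)/2) *
            (Real.exp (lam / r) * Real.exp (-(lam/2) * ‖η - x‖^2 / r))) * c := by gcongr
      _ = _ := by
          rw [show -((n : ℝ) + 1)/2 = (-(1/2) : ℝ) + -(n:ℝ)/2 by ring, Real.rpow_add hr]
          ring
  · refine (aux_gauss (lam := lam/2) (a := K0 * c * Real.exp (lam / r) * r ^ (-(1/2) : ℝ))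
      (by positivity) hr x _ ?_ ?_).1
    · exact Measurable.aestronglyMeasurable (by fun_prop)
    · intro η
      rw [Real.norm_of_nonneg (by positivity)]
  · refine ae_of_all _ fun η y _ => ?_
    rw [DG_eq G y η h0 h1 h2]
    exact (hG.2.1 s y τ η h0 h1 h2).hasFDerivAt.smul_const (H η)

theorem aux_meas_G_int {n m : ℕ} {T K0 lam : ℝ} {G : ℝ → En n → ℝ → En n → ℝ}
    (hG : KernelHyp n T K0 lam G) {α : Type*} [MeasurableSpace α]
    (F : α → ℝ → En n → En m) (hF : Measurable (fun q : α × ℝ × En n => F q.1 q.2.1 q.2.2)) :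
    Measurable (fun q : (α × ℝ × En n) × ℝ =>
      ∫ η, G q.1.2.1 q.1.2.2 q.2 η • F q.1.1 q.2 η) := by
  refine (StronglyMeasurable.integral_prod_right'
    (f := fun z : ((α × ℝ × En n) × ℝ) × En n =>
      G z.1.1.2.1 z.1.1.2.2 z.1.2 z.2 • F z.1.1.1 z.1.2 z.2) ?_).measurable
  have a1 := hG.1.comp (g := fun q : ℝ × En n × ℝ × En n => G q.1 q.2.1 q.2.2.1 q.2.2.2)
      (f := fun z : ((α × ℝ × En n) × ℝ) × En n => (z.1.1.2.1, z.1.1.2.2, z.1.2, z.2))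
      (by fun_prop)
  have a2 := hF.comp (f := fun z : ((α × ℝ × En n) × ℝ) × En n => (z.1.1.1, z.1.2, z.2))
      (by fun_prop)
  exact (a1.smul a2).stronglyMeasurable

theorem aux_meas_DG_int {n m : ℕ} {T K0 lam : ℝ} {G : ℝ → En n → ℝ → En n → ℝ}
    (hG : KernelHyp n T K0 lam G) {α : Type*} [MeasurableSpace α]
    (F : α → ℝ → En n → En m) (hF : Measurable (fun q : α × ℝ × En n => F q.1 q.2.1 q.2.2)) :
    Measurable (fun q : (α × ℝ × En n) × ℝ =>
      ∫ η, (DG T G q.1.2.1 q.1.2.2 q.2 η).smulRight (F q.1.1 q.2 η)) := by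
  refine (StronglyMeasurable.integral_prod_right'
    (f := fun z : ((α × ℝ × En n) × ℝ) × En n =>
      (DG T G z.1.1.2.1 z.1.1.2.2 z.1.2 z.2).smulRight (F z.1.1.1 z.1.2 z.2)) ?_).measurable
  refine (aux_meas_smulRight ?_ ?_).stronglyMeasurable
  · exact (DG_meas hG).comp
      (f := fun z : ((α × ℝ × En n) × ℝ) × En n => (z.1.1.2.1, z.1.1.2.2, z.1.2, z.2))
      (by fun_prop)
  · exact hF.comp (f := fun z : ((α × ℝ × En n) × ℝ) × En n => (z.1.1.1, z.1.2, z.2)) (by fun_prop)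

theorem aux_meas_time {α : Type*} [MeasurableSpace α] {V : Type*} [NormedAddCommGroup V]
    [NormedSpace ℝ V] [MeasurableSpace V] [BorelSpace V] [SecondCountableTopology V]
    (T : ℝ) (I : α → ℝ → V) (hI : Measurable (fun q : α × ℝ => I q.1 q.2))
    (s : α → ℝ) (hs : Measurable s) :
    Measurable (fun a => ∫ τ in Ioc (s a) T, I a τ) := by
  have : (fun a => ∫ τ in Ioc (s a) T, I a τ) =
      fun a => ∫ τ, {q : α × ℝ | s q.1 < q.2 ∧ q.2 ≤ T}.indicator (fun q => I q.1 q.2) (a, τ) := by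
    funext a
    rw [← integral_indicator measurableSet_Ioc]
    rfl
  rw [this]
  refine (StronglyMeasurable.integral_prod_right'
    (f := {q : α × ℝ | s q.1 < q.2 ∧ q.2 ≤ T}.indicator (fun q => I q.1 q.2)) ?_).measurable
  refine (hI.indicator ?_).stronglyMeasurable
  exact (measurableSet_lt (hs.comp measurable_fst) measurable_snd).inter
        (measurableSet_le measurable_snd measurable_const)

/-- the generator evaluated along a pair `(u, Z)`. -/
def Fw {n m d : ℕ} (T : ℝ) (G : ℝ → En n → ℝ → En n → ℝ)
    (g : ℝ → ℝ → En n → En n → En m → (En d →L[ℝ] En m) → (En d →L[ℝ] En m) → En m)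
    (σ : ℝ → En n → (En d →L[ℝ] En n))
    (u : ℝ → ℝ → En n → En n → En m) (Z : ℝ → ℝ → En n → En n → (En n →L[ℝ] En m))
    (t τ : ℝ) (ξ η : En n) : En m :=
  g t τ ξ η (u τ τ η η) ((Z t τ ξ η).comp (σ τ η))
    ((∫ ηb : En n, (DG T G t ξ τ ηb).smulRight (u τ τ ηb ηb)).comp (σ τ η))

def Phi1 {n m d : ℕ} (T : ℝ) (G : ℝ → En n → ℝ → En n → ℝ)
    (g : ℝ → ℝ → En n → En n → En m → (En d →L[ℝ] En m) → (En d →L[ℝ] En m) → En m)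
    (σ : ℝ → En n → (En d →L[ℝ] En n))
    (u : ℝ → ℝ → En n → En n → En m) (Z : ℝ → ℝ → En n → En n → (En n →L[ℝ] En m))
    (t s : ℝ) (ξ x : En n) : En m :=
  ∫ τ in Ioc s T, ∫ η : En n, G s x τ η • Fw T G g σ u Z t τ ξ η

def Phi2 {n m d : ℕ} (T : ℝ) (G : ℝ → En n → ℝ → En n → ℝ)
    (g : ℝ → ℝ → En n → En n → En m → (En d →L[ℝ] En m) → (En d →L[ℝ] En m) → En m)
    (σ : ℝ → En n → (En d →L[ℝ] En n))
    (u : ℝ → ℝ → En n → En n → En m) (Z : ℝ → ℝ → En n → En n → (En n →L[ℝ] En m))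
    (t s : ℝ) (ξ x : En n) : En n →L[ℝ] En m :=
  ∫ τ in Ioc s T, ∫ η : En n, (DG T G s x τ η).smulRight (Fw T G g σ u Z t τ ξ η)

/-- joint measurability of a function of four variables. -/
def M4 {n : ℕ} {V : Type*} [MeasurableSpace V] (u : ℝ → ℝ → En n → En n → V) : Prop :=
  Measurable (fun q : ℝ × ℝ × En n × En n => u q.1 q.2.1 q.2.2.1 q.2.2.2)

section
variable {n m d : ℕ} {T K0 lam L : ℝ} {G : ℝ → En n → ℝ → En n → ℝ}
    {g : ℝ → ℝ → En n → En n → En m → (En d →L[ℝ] En m) → (En d →L[ℝ] En m) → En m}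
    {σ : ℝ → En n → (En d →L[ℝ] En n)}
    {u u' : ℝ → ℝ → En n → En n → En m} {Z Z' : ℝ → ℝ → En n → En n → (En n →L[ℝ] En m)}

theorem M4.comp {V α : Type*} [MeasurableSpace V] [MeasurableSpace α]
    {w : ℝ → ℝ → En n → En n → V} (hw : M4 w)
    {a b : α → ℝ} {c e : α → En n} (ha : Measurable a) (hb : Measurable b) (hc : Measurable c)
    (he : Measurable e) : Measurable (fun q => w (a q) (b q) (c q) (e q)) :=
  Measurable.comp (f := fun q => (a q, b q, c q, e q)) hw
    (ha.prodMk (hb.prodMk (hc.prodMk he)))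

theorem Fw_meas (hG : KernelHyp n T K0 lam G) (hg : GSHyp n m d L g σ) (hu : M4 u) (hZ : M4 Z) :
    M4 (Fw T G g σ u Z) := by
  have hsig : Measurable (fun q : ℝ × ℝ × En n × En n => σ q.2.1 q.2.2.2) :=
    hg.2.2.2.1.comp (f := fun q : ℝ × ℝ × En n × En n => (q.2.1, q.2.2.2)) (by fun_prop)
  have h1 : Measurable (fun q : ℝ × ℝ × En n × En n => u q.2.1 q.2.1 q.2.2.2 q.2.2.2) :=
    hu.comp (by fun_prop) (by fun_prop) (by fun_prop) (by fun_prop)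
  have h2 := aux_meas_comp hZ hsig
  have h3 : Measurable (fun q : ℝ × ℝ × En n × En n =>
      ∫ ηb : En n, (DG T G q.1 q.2.2.1 q.2.1 ηb).smulRight (u q.2.1 q.2.1 ηb ηb)) := by
    have := aux_meas_DG_int hG (α := Unit) (fun _ τ ηb => u τ τ ηb ηb)
      (hu.comp (by fun_prop) (by fun_prop) (by fun_prop) (by fun_prop))
    exact this.comp (f := fun q : ℝ × ℝ × En n × En n => (((), q.1, q.2.2.1), q.2.1))
      (by fun_prop)
  have h4 := aux_meas_comp h3 hsig
  exact hg.1.comp (f := fun q : ℝ × ℝ × En n × En n => (q.1, q.2.1, q.2.2.1, q.2.2.2,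
    u q.2.1 q.2.1 q.2.2.2 q.2.2.2, (Z q.1 q.2.1 q.2.2.1 q.2.2.2).comp (σ q.2.1 q.2.2.2),
    (∫ ηb : En n, (DG T G q.1 q.2.2.1 q.2.1 ηb).smulRight (u q.2.1 q.2.1 ηb ηb)).comp
      (σ q.2.1 q.2.2.2)))
    (measurable_fst.prodMk ((measurable_fst.comp measurable_snd).prodMk
      ((measurable_fst.comp (measurable_snd.comp measurable_snd)).prodMk
      ((measurable_snd.comp (measurable_snd.comp measurable_snd)).prodMk
        (h1.prodMk (h2.prodMk h4))))))

theorem Fw_le (hg : GSHyp n m d L g σ) (t τ : ℝ) (ξ η : En n) :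
    ‖Fw T G g σ u Z t τ ξ η‖ ≤ L := hg.2.1 _ _ _ _ _ _ _

theorem Fw_meas' (hG : KernelHyp n T K0 lam G) (hg : GSHyp n m d L g σ) (hu : M4 u) (hZ : M4 Z)
    (t τ : ℝ) (ξ : En n) : Measurable (fun η => Fw T G g σ u Z t τ ξ η) :=
  (Fw_meas hG hg hu hZ).comp (by fun_prop) (by fun_prop) (by fun_prop) (by fun_prop)

theorem inner1_meas (hG : KernelHyp n T K0 lam G) (hg : GSHyp n m d L g σ)
    (hu : M4 u) (hZ : M4 Z) :
    Measurable (fun q : (ℝ × ℝ × En n × En n) × ℝ =>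
      ∫ η : En n, G q.1.2.1 q.1.2.2.2 q.2 η • Fw T G g σ u Z q.1.1 q.2 q.1.2.2.1 η) := by
  have := aux_meas_G_int hG (α := ℝ × En n) (fun a τ η => Fw T G g σ u Z a.1 τ a.2 η)
    ((Fw_meas hG hg hu hZ).comp (by fun_prop) (by fun_prop) (by fun_prop) (by fun_prop))
  exact this.comp (f := fun q : (ℝ × ℝ × En n × En n) × ℝ =>
    (((q.1.1, q.1.2.2.1), q.1.2.1, q.1.2.2.2), q.2)) (by fun_prop)

theorem inner2_meas (hG : KernelHyp n T K0 lam G) (hg : GSHyp n m d L g σ)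
    (hu : M4 u) (hZ : M4 Z) :
    Measurable (fun q : (ℝ × ℝ × En n × En n) × ℝ =>
      ∫ η : En n, (DG T G q.1.2.1 q.1.2.2.2 q.2 η).smulRight
        (Fw T G g σ u Z q.1.1 q.2 q.1.2.2.1 η)) := by
  have := aux_meas_DG_int hG (α := ℝ × En n) (fun a τ η => Fw T G g σ u Z a.1 τ a.2 η)
    ((Fw_meas hG hg hu hZ).comp (by fun_prop) (by fun_prop) (by fun_prop) (by fun_prop))
  exact this.comp (f := fun q : (ℝ × ℝ × En n × En n) × ℝ =>
    (((q.1.1, q.1.2.2.1), q.1.2.1, q.1.2.2.2), q.2)) (by fun_prop)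

theorem Phi1_meas (hG : KernelHyp n T K0 lam G) (hg : GSHyp n m d L g σ)
    (hu : M4 u) (hZ : M4 Z) : M4 (Phi1 T G g σ u Z) :=
  aux_meas_time T (fun (q : ℝ × ℝ × En n × En n) τ =>
    ∫ η : En n, G q.2.1 q.2.2.2 τ η • Fw T G g σ u Z q.1 τ q.2.2.1 η)
    (inner1_meas hG hg hu hZ) (fun q => q.2.1) (by fun_prop)

theorem Phi2_meas (hG : KernelHyp n T K0 lam G) (hg : GSHyp n m d L g σ)
    (hu : M4 u) (hZ : M4 Z) : M4 (Phi2 T G g σ u Z) :=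
  aux_meas_time T (fun (q : ℝ × ℝ × En n × En n) τ =>
    ∫ η : En n, (DG T G q.2.1 q.2.2.2 τ η).smulRight (Fw T G g σ u Z q.1 τ q.2.2.1 η))
    (inner2_meas hG hg hu hZ) (fun q => q.2.1) (by fun_prop)

theorem inner1_meas' (hG : KernelHyp n T K0 lam G) (hg : GSHyp n m d L g σ)
    (hu : M4 u) (hZ : M4 Z) (t s : ℝ) (ξ x : En n) :
    Measurable (fun τ => ∫ η : En n, G s x τ η • Fw T G g σ u Z t τ ξ η) :=
  (inner1_meas hG hg hu hZ).comp (f := fun τ : ℝ => ((t, s, ξ, x), τ)) (by fun_prop)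

theorem inner2_meas' (hG : KernelHyp n T K0 lam G) (hg : GSHyp n m d L g σ)
    (hu : M4 u) (hZ : M4 Z) (t s : ℝ) (ξ x : En n) :
    Measurable (fun τ => ∫ η : En n, (DG T G s x τ η).smulRight (Fw T G g σ u Z t τ ξ η)) :=
  (inner2_meas hG hg hu hZ).comp (f := fun τ : ℝ => ((t, s, ξ, x), τ)) (by fun_prop)

theorem Phi1_bd (hlam : 0 < lam) (hG : KernelHyp n T K0 lam G) (hg : GSHyp n m d L g σ)
    (hu : M4 u) (hZ : M4 Z) {t s : ℝ} (ξ x : En n) (h0 : 0 ≤ s) (hsT : s ≤ T) :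
    IntegrableOn (fun τ => ∫ η : En n, G s x τ η • Fw T G g σ u Z t τ ξ η) (Ioc s T) ∧
    ‖Phi1 T G g σ u Z t s ξ x‖ ≤ K0 * (Real.pi / lam) ^ ((n : ℝ)/2) * L * (T - s) := by
  have := aux_time (γ := 0) (by norm_num) hsT _ 
    (inner1_meas' hG hg hu hZ t s ξ x).aestronglyMeasurable
    (fun τ hτ => by
      simpa using (aux_G hlam hG x h0 hτ.1 hτ.2 _ (Fw_meas' hG hg hu hZ t τ ξ)
        (fun η => Fw_le hg t τ ξ η)).2)
  refine ⟨this.1, this.2.trans (le_of_eq (by simp))⟩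

theorem Phi2_bd (hlam : 0 < lam) (hG : KernelHyp n T K0 lam G) (hg : GSHyp n m d L g σ)
    (hu : M4 u) (hZ : M4 Z) {t s : ℝ} (ξ x : En n) (h0 : 0 ≤ s) (hsT : s ≤ T) :
    IntegrableOn (fun τ => ∫ η : En n, (DG T G s x τ η).smulRight (Fw T G g σ u Z t τ ξ η))
      (Ioc s T) ∧
    ‖Phi2 T G g σ u Z t s ξ x‖ ≤
      K0 * (Real.pi / lam) ^ ((n : ℝ)/2) * L * ((T - s) ^ (1 - 1/2 : ℝ) / (1 - 1/2 : ℝ)) :=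
  aux_time (γ := 1/2) (by norm_num) hsT _ 
    (inner2_meas' hG hg hu hZ t s ξ x).aestronglyMeasurable
    (fun τ hτ => (aux_DG hlam hG x h0 hτ.1 hτ.2 _ (Fw_meas' hG hg hu hZ t τ ξ)
        (fun η => Fw_le hg t τ ξ η)).2)

theorem Phi_deriv (hlam : 0 < lam) (hK0 : 0 < K0) (hG : KernelHyp n T K0 lam G)
    (hg : GSHyp n m d L g σ)
    (hu : M4 u) (hZ : M4 Z) {t s : ℝ} (ξ x : En n) (h0 : 0 ≤ s) (hsT : s ≤ T) :
    HasFDerivAt (fun y => Phi1 T G g σ u Z t s ξ y) (Phi2 T G g σ u Z t s ξ x) x := by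
  have hbd : ∀ y, ∀ τ ∈ Ioc s T, ‖∫ η : En n, (DG T G s y τ η).smulRight (Fw T G g σ u Z t τ ξ η)‖
      ≤ K0 * (Real.pi / lam) ^ ((n : ℝ)/2) * L * (τ - s) ^ (-(1/2) : ℝ) := fun y τ hτ =>
    (aux_DG hlam hG y h0 hτ.1 hτ.2 _ (Fw_meas' hG hg hu hZ t τ ξ)
        (fun η => Fw_le hg t τ ξ η)).2
  refine hasFDerivAt_integral_of_dominated_of_fderiv_le (𝕜 := ℝ)
    (F := fun y τ => ∫ η : En n, G s y τ η • Fw T G g σ u Z t τ ξ η)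
    (F' := fun y τ => ∫ η : En n, (DG T G s y τ η).smulRight (Fw T G g σ u Z t τ ξ η))
    (bound := fun τ => K0 * (Real.pi / lam) ^ ((n : ℝ)/2) * L * (τ - s) ^ (-(1/2) : ℝ))
    (Metric.ball_mem_nhds x one_pos) ?_ (Phi1_bd hlam hG hg hu hZ ξ x h0 hsT).1
    (Phi2_bd hlam hG hg hu hZ ξ x h0 hsT).1.aestronglyMeasurable ?_ ?_ ?_
  · exact Eventually.of_forall fun y => (inner1_meas' hG hg hu hZ t s ξ y).aestronglyMeasurable
  · exact (ae_restrict_iff' measurableSet_Ioc).2 (ae_of_all _ fun τ hτ y _ => hbd y τ hτ)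
  · refine (aux_time (γ := 1/2) (a := K0 * (Real.pi / lam) ^ ((n : ℝ)/2) * L) (by norm_num) hsT _
      (Measurable.aestronglyMeasurable (by fun_prop)) (fun τ hτ => ?_)).1
    rw [Real.norm_of_nonneg ((norm_nonneg _).trans (hbd x τ hτ))]
  · exact (ae_restrict_iff' measurableSet_Ioc).2 (ae_of_all _ fun τ hτ y _ =>
      aux_diff_inner hlam hK0 hG y h0 hτ.1 hτ.2 _ (Fw_meas' hG hg hu hZ t τ ξ)
        (fun η => Fw_le hg t τ ξ η))

/-- the distance predicate. -/
def DD (S T : ℝ) (u u' : ℝ → ℝ → En n → En n → En m)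
    (Z Z' : ℝ → ℝ → En n → En n → (En n →L[ℝ] En m)) (c : ℝ) : Prop :=
  ∀ t s : ℝ, ∀ ξ x : En n, 0 ≤ t → t ≤ s → S ≤ s → s ≤ T →
    ‖u t s ξ x - u' t s ξ x‖ ≤ c ∧
      (t < s → ‖Z t s ξ x - Z' t s ξ x‖ ≤ c * (s - t) ^ (-(1/4) : ℝ))

def BB (S T : ℝ) (u : ℝ → ℝ → En n → En n → En m) : Prop :=
  ∃ M, ∀ t s : ℝ, ∀ ξ x : En n, 0 ≤ t → t ≤ s → S ≤ s → s ≤ T → ‖u t s ξ x‖ ≤ M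

def AA (n : ℕ) (T K0 lam L : ℝ) : ℝ :=
  L * (T ^ (1/2 : ℝ) + L * T ^ (1/4 : ℝ) + L * (K0 * (Real.pi / lam) ^ ((n : ℝ)/2)))

theorem Fw_diff (hlam : 0 < lam) (hK0 : 0 < K0) (hL : 0 < L) (hG : KernelHyp n T K0 lam G)
    (hg : GSHyp n m d L g σ)
    (hu : M4 u) (hu' : M4 u') {S : ℝ} (hb : BB S T u) (hb' : BB S T u')
    {c : ℝ} (hc : 0 ≤ c) (hD : DD S T u u' Z Z' c) {t τ : ℝ} (ξ η : En n) (h0 : 0 ≤ t) (h1 : t < τ)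
    (hS : S ≤ τ) (hτ : τ ≤ T) :
    ‖Fw T G g σ u Z t τ ξ η - Fw T G g σ u' Z' t τ ξ η‖ ≤
      AA n T K0 lam L * c * (τ - t) ^ (-(1/2) : ℝ) := by
  have hr : 0 < τ - t := sub_pos.2 h1
  have h0τ : 0 ≤ τ := h0.trans h1.le
  set κ := K0 * (Real.pi / lam) ^ ((n : ℝ)/2) with hκ
  have hκ0 : 0 ≤ κ := by positivity
  have e1 : ∀ η, ‖u τ τ η η - u' τ τ η η‖ ≤ c := fun η => (hD τ τ η η h0τ le_rfl hS hτ).1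
  have e2 : ‖Z t τ ξ η - Z' t τ ξ η‖ ≤ c * (τ - t) ^ (-(1/4) : ℝ) :=
    (hD t τ ξ η h0 h1.le hS hτ).2 h1
  obtain ⟨M, hM⟩ := hb
  obtain ⟨M', hM'⟩ := hb'
  have i1 := (aux_DG hlam hG ξ h0 h1 hτ (fun η => u τ τ η η)
    (hu.comp (by fun_prop) (by fun_prop) (by fun_prop) (by fun_prop))
    (fun η => hM τ τ η η h0τ le_rfl hS hτ)).1
  have i2 := (aux_DG hlam hG ξ h0 h1 hτ (fun η => u' τ τ η η)
    (hu'.comp (by fun_prop) (by fun_prop) (by fun_prop) (by fun_prop))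
    (fun η => hM' τ τ η η h0τ le_rfl hS hτ)).1
  have e3 := (aux_DG hlam hG ξ h0 h1 hτ (fun η => u τ τ η η - u' τ τ η η)
    ((hu.comp (by fun_prop) (by fun_prop) (by fun_prop) (by fun_prop)).sub
      (hu'.comp (by fun_prop) (by fun_prop) (by fun_prop) (by fun_prop))) e1).2
  have e4 : (∫ ηb, (DG T G t ξ τ ηb).smulRight (u τ τ ηb ηb - u' τ τ ηb ηb)) =
      (∫ ηb, (DG T G t ξ τ ηb).smulRight (u τ τ ηb ηb)) -
      ∫ ηb, (DG T G t ξ τ ηb).smulRight (u' τ τ ηb ηb) := by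
    rw [← integral_sub i1 i2]
    congr 1; funext ηb
    ext1 v; simp [smul_sub]
  rw [e4] at e3
  have hLip := hg.2.2.1 t τ ξ η (u τ τ η η) (u' τ τ η η) ((Z t τ ξ η).comp (σ τ η))
    ((Z' t τ ξ η).comp (σ τ η))
    ((∫ ηb : En n, (DG T G t ξ τ ηb).smulRight (u τ τ ηb ηb)).comp (σ τ η))
    ((∫ ηb : En n, (DG T G t ξ τ ηb).smulRight (u' τ τ ηb ηb)).comp (σ τ η))
  rw [← ContinuousLinearMap.sub_comp, ← ContinuousLinearMap.sub_comp] at hLip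
  refine hLip.trans ?_
  have e5 := (ContinuousLinearMap.opNorm_comp_le (Z t τ ξ η - Z' t τ ξ η) (σ τ η)).trans
    (mul_le_mul e2 (hg.2.2.2.2 τ η) (norm_nonneg _) ((norm_nonneg _).trans e2))
  have e6 := (ContinuousLinearMap.opNorm_comp_le
    ((∫ ηb : En n, (DG T G t ξ τ ηb).smulRight (u τ τ ηb ηb)) -
      (∫ ηb : En n, (DG T G t ξ τ ηb).smulRight (u' τ τ ηb ηb))) (σ τ η)).trans
    (mul_le_mul e3 (hg.2.2.2.2 τ η) (norm_nonneg _) ((norm_nonneg _).trans e3))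
  have f1 : (1:ℝ) ≤ T ^ (1/2 : ℝ) * (τ - t) ^ (-(1/2) : ℝ) := by
    have : (τ - t) ^ (1/2 : ℝ) ≤ T ^ (1/2 : ℝ) :=
      Real.rpow_le_rpow hr.le (by linarith) (by norm_num)
    calc (1:ℝ) = (τ - t) ^ (1/2 : ℝ) * (τ - t) ^ (-(1/2) : ℝ) := by
          rw [← Real.rpow_add hr]; norm_num
      _ ≤ _ := by gcongr
  have f2 : (τ - t) ^ (-(1/4) : ℝ) ≤ T ^ (1/4 : ℝ) * (τ - t) ^ (-(1/2) : ℝ) := by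
    have : (τ - t) ^ (1/4 : ℝ) ≤ T ^ (1/4 : ℝ) :=
      Real.rpow_le_rpow hr.le (by linarith) (by norm_num)
    calc _ = (τ - t) ^ (1/4 : ℝ) * (τ - t) ^ (-(1/2) : ℝ) := by
          rw [← Real.rpow_add hr]; norm_num
      _ ≤ _ := by gcongr
  calc _ ≤ L * (c * 1 + c * (τ - t) ^ (-(1/4) : ℝ) * L + κ * c * (τ - t) ^ (-(1/2) : ℝ) * L) := by
        gcongr
        rw [mul_one]; exact e1 η
    _ ≤ L * (c * (T ^ (1/2 : ℝ) * (τ - t) ^ (-(1/2) : ℝ)) +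
          c * (T ^ (1/4 : ℝ) * (τ - t) ^ (-(1/2) : ℝ)) * L +
          κ * c * (τ - t) ^ (-(1/2) : ℝ) * L) := by gcongr
    _ = _ := by unfold AA; ring

theorem contraction (hlam : 0 < lam) (hK0 : 0 < K0) (hL : 0 < L) (hT : 0 < T)
    (hG : KernelHyp n T K0 lam G) (hg : GSHyp n m d L g σ)
    (hu : M4 u) (hu' : M4 u') (hZ : M4 Z) (hZ' : M4 Z') {S δ : ℝ} (hb : BB S T u) (hb' : BB S T u')
    (hδ : T - S ≤ δ) (hδ1 : δ ≤ 1)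
    (hδ2 : 8 * (K0 * (Real.pi / lam) ^ ((n : ℝ)/2)) * AA n T K0 lam L * δ ^ (1/4 : ℝ) ≤ 1)
    {c : ℝ} (hc : 0 ≤ c) (hD : DD S T u u' Z Z' c) :
    DD S T (Phi1 T G g σ u Z) (Phi1 T G g σ u' Z') (Phi2 T G g σ u Z) (Phi2 T G g σ u' Z')
      (c / 2) := by
  intro t s ξ x ht hts hSs hsT
  have hs0 : 0 ≤ s := ht.trans hts
  have hA : 0 ≤ AA n T K0 lam L := by unfold AA; positivity
  set κ := K0 * (Real.pi / lam) ^ ((n : ℝ)/2) with hκ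
  have hκ0 : 0 ≤ κ := by positivity
  set A := AA n T K0 lam L with hAd
  have hF : ∀ τ ∈ Ioc s T, ∀ η, ‖Fw T G g σ u Z t τ ξ η - Fw T G g σ u' Z' t τ ξ η‖ ≤
      A * c * (τ - t) ^ (-(1/2) : ℝ) := fun τ hτ η =>
    Fw_diff hlam hK0 hL hG hg hu hu' hb hb' hc hD ξ η ht (hts.trans_lt hτ.1)
      (hSs.trans hτ.1.le) hτ.2
  have hFm : ∀ τ, Measurable (fun η => Fw T G g σ u Z t τ ξ η - Fw T G g σ u' Z' t τ ξ η) :=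
    fun τ => (Fw_meas' hG hg hu hZ t τ ξ).sub (Fw_meas' hG hg hu' hZ' t τ ξ)
  have hTs0 : 0 ≤ T - s := sub_nonneg.2 hsT
  have hTs : T - s ≤ δ := by linarith
  have hδ0 : 0 ≤ δ := hTs0.trans hTs
  have q4 : (T - s) ^ (1/4 : ℝ) ≤ δ ^ (1/4 : ℝ) := Real.rpow_le_rpow hTs0 hTs (by norm_num)
  have q2 : (T - s) ^ (1/2 : ℝ) ≤ δ ^ (1/4 : ℝ) :=
    (Real.rpow_le_rpow hTs0 hTs (by norm_num)).trans
      (Real.rpow_le_rpow_of_exponent_ge' hδ0 hδ1 (by norm_num) (by norm_num))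
  have hfin : κ * A * c * δ ^ (1/4 : ℝ) * 4 ≤ c / 2 := by nlinarith
  constructor
  · have e : Phi1 T G g σ u Z t s ξ x - Phi1 T G g σ u' Z' t s ξ x =
        ∫ τ in Ioc s T, ((∫ η : En n, G s x τ η • Fw T G g σ u Z t τ ξ η) -
          ∫ η : En n, G s x τ η • Fw T G g σ u' Z' t τ ξ η) :=
      (integral_sub (Phi1_bd hlam hG hg hu hZ ξ x hs0 hsT).1
        (Phi1_bd hlam hG hg hu' hZ' ξ x hs0 hsT).1).symm
    rw [e]
    refine (aux_time (γ := 1/2) (a := κ * A * c) (by norm_num) hsT _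
      ((inner1_meas' hG hg hu hZ t s ξ x).sub
        (inner1_meas' hG hg hu' hZ' t s ξ x)).aestronglyMeasurable ?_).2.trans ?_
    · intro τ hτ
      rw [Pi.sub_apply]
      rw [← integral_sub (aux_G hlam hG x hs0 hτ.1 hτ.2 _ (Fw_meas' hG hg hu hZ t τ ξ)
        (fun η => Fw_le hg t τ ξ η)).1 (aux_G hlam hG x hs0 hτ.1 hτ.2 _
          (Fw_meas' hG hg hu' hZ' t τ ξ) (fun η => Fw_le hg t τ ξ η)).1]
      simp only [← smul_sub]
      refine (aux_G hlam hG x hs0 hτ.1 hτ.2 _ (hFm τ) (hF τ hτ)).2.trans ?_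
      have : (τ - t) ^ (-(1/2) : ℝ) ≤ (τ - s) ^ (-(1/2) : ℝ) :=
        Real.rpow_le_rpow_of_nonpos (sub_pos.2 hτ.1) (by linarith) (by norm_num)
      calc _ ≤ κ * (A * c * (τ - s) ^ (-(1/2) : ℝ)) := by gcongr
        _ = _ := by ring
    · refine le_trans ?_ hfin
      have : (0:ℝ) ≤ κ * A * c := by positivity
      rw [show (1 - 1/2 : ℝ) = 1/2 by norm_num]
      have q0 : 0 ≤ δ ^ (1/4 : ℝ) := by positivity
      have : (T - s) ^ (1/2 : ℝ) / (1/2) ≤ δ ^ (1/4 : ℝ) * 4 := by linarith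
      calc _ ≤ κ * A * c * (δ ^ (1/4 : ℝ) * 4) := by gcongr
        _ = _ := by ring
  · intro hlt
    have hst : 0 < s - t := sub_pos.2 hlt
    have e : Phi2 T G g σ u Z t s ξ x - Phi2 T G g σ u' Z' t s ξ x =
        ∫ τ in Ioc s T, ((∫ η : En n, (DG T G s x τ η).smulRight (Fw T G g σ u Z t τ ξ η)) -
          ∫ η : En n, (DG T G s x τ η).smulRight (Fw T G g σ u' Z' t τ ξ η)) :=
      (integral_sub (Phi2_bd hlam hG hg hu hZ ξ x hs0 hsT).1
        (Phi2_bd hlam hG hg hu' hZ' ξ x hs0 hsT).1).symm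
    rw [e]
    refine (aux_time (γ := 3/4) (a := κ * A * c * (s - t) ^ (-(1/4) : ℝ)) (by norm_num) hsT _
      ((inner2_meas' hG hg hu hZ t s ξ x).sub
        (inner2_meas' hG hg hu' hZ' t s ξ x)).aestronglyMeasurable ?_).2.trans ?_
    · intro τ hτ
      have hτs : 0 < τ - s := sub_pos.2 hτ.1
      rw [Pi.sub_apply]
      rw [← integral_sub (aux_DG hlam hG x hs0 hτ.1 hτ.2 _ (Fw_meas' hG hg hu hZ t τ ξ)
        (fun η => Fw_le hg t τ ξ η)).1 (aux_DG hlam hG x hs0 hτ.1 hτ.2 _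
          (Fw_meas' hG hg hu' hZ' t τ ξ) (fun η => Fw_le hg t τ ξ η)).1]
      have e7 : ∀ η, (DG T G s x τ η).smulRight (Fw T G g σ u Z t τ ξ η) -
          (DG T G s x τ η).smulRight (Fw T G g σ u' Z' t τ ξ η) =
          (DG T G s x τ η).smulRight (Fw T G g σ u Z t τ ξ η - Fw T G g σ u' Z' t τ ξ η) := by
        intro η; ext1 v; simp [smul_sub]
      simp only [e7]
      refine (aux_DG hlam hG x hs0 hτ.1 hτ.2 _ (hFm τ) (hF τ hτ)).2.trans ?_
      have e8 : (τ - t) ^ (-(1/2) : ℝ) ≤ (s - t) ^ (-(1/4) : ℝ) * (τ - s) ^ (-(1/4) : ℝ) := by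
        have hτt : 0 < τ - t := by linarith
        rw [show (-(1/2) : ℝ) = -(1/4) + -(1/4) by norm_num, Real.rpow_add hτt]
        have a1 : (τ - t) ^ (-(1/4) : ℝ) ≤ (τ - s) ^ (-(1/4) : ℝ) :=
          Real.rpow_le_rpow_of_nonpos hτs (by linarith) (by norm_num)
        have a2 : (τ - t) ^ (-(1/4) : ℝ) ≤ (s - t) ^ (-(1/4) : ℝ) :=
          Real.rpow_le_rpow_of_nonpos hst (by linarith [hτ.1]) (by norm_num)
        gcongr
      have e9 : (τ - s) ^ (-(3/4) : ℝ) = (τ - s) ^ (-(1/4) : ℝ) * (τ - s) ^ (-(1/2) : ℝ) := by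
        rw [← Real.rpow_add hτs]; norm_num
      calc _ ≤ κ * (A * c * ((s - t) ^ (-(1/4) : ℝ) * (τ - s) ^ (-(1/4) : ℝ)))
              * (τ - s) ^ (-(1/2) : ℝ) := by gcongr
        _ = _ := by rw [e9]; ring
    · rw [show (1 - 3/4 : ℝ) = 1/4 by norm_num]
      calc _ = (κ * A * c * (T - s) ^ (1/4 : ℝ) * 4) * (s - t) ^ (-(1/4) : ℝ) := by ring
        _ ≤ (κ * A * c * δ ^ (1/4 : ℝ) * 4) * (s - t) ^ (-(1/4) : ℝ) := by gcongr
        _ ≤ _ := by gcongr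

end

section
variable {n m d : ℕ} {T K0 lam L : ℝ} {G : ℝ → En n → ℝ → En n → ℝ}
    {g : ℝ → ℝ → En n → En n → En m → (En d →L[ℝ] En m) → (En d →L[ℝ] En m) → En m}
    {σ : ℝ → En n → (En d →L[ℝ] En n)}

theorem aux_geom {a C : ℝ} (h : ∀ k : ℕ, a ≤ C / 2 ^ k) : a ≤ 0 := by
  have : Tendsto (fun k : ℕ => C / 2 ^ k) atTop (𝓝 0) := by
    have := (tendsto_pow_atTop_nhds_zero_of_lt_one (r := (1/2:ℝ)) (by norm_num)
      (by norm_num)).const_mul C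
    simpa [div_eq_mul_inv] using this
  exact ge_of_tendsto' this h

theorem DD_zero {S C : ℝ} {u u' : ℝ → ℝ → En n → En n → En m}
    {Z Z' : ℝ → ℝ → En n → En n → (En n →L[ℝ] En m)}
    (h : ∀ k : ℕ, DD S T u u' Z Z' (C / 2 ^ k)) {t s : ℝ} (ξ x : En n) (h0 : 0 ≤ t)
    (hts : t ≤ s) (hS : S ≤ s) (hsT : s ≤ T) :
    u t s ξ x = u' t s ξ x ∧ (t < s → Z t s ξ x = Z' t s ξ x) := by
  constructor
  · rw [← sub_eq_zero, ← norm_le_zero_iff]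
    exact aux_geom fun k => (h k t s ξ x h0 hts hS hsT).1
  · intro hlt
    rw [← sub_eq_zero, ← norm_le_zero_iff]
    refine aux_geom (C := C * (s - t) ^ (-(1/4) : ℝ)) fun k => ?_
    refine ((h k t s ξ x h0 hts hS hsT).2 hlt).trans (le_of_eq (by ring))

theorem DD_trans {S c c' : ℝ} {u u' u'' : ℝ → ℝ → En n → En n → En m}
    {Z Z' Z'' : ℝ → ℝ → En n → En n → (En n →L[ℝ] En m)}
    (h : DD S T u u' Z Z' c) (h' : DD S T u' u'' Z' Z'' c') : DD S T u u'' Z Z'' (c + c') := by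
  intro t s ξ x h0 hts hS hsT
  have a := h t s ξ x h0 hts hS hsT
  have b := h' t s ξ x h0 hts hS hsT
  refine ⟨(norm_sub_le_norm_sub_add_norm_sub _ _ _).trans (add_le_add a.1 b.1), fun hlt => ?_⟩
  rw [add_mul]
  exact (norm_sub_le_norm_sub_add_norm_sub _ _ _).trans (add_le_add (a.2 hlt) (b.2 hlt))

theorem DD_symm {S c : ℝ} {u u' : ℝ → ℝ → En n → En n → En m}
    {Z Z' : ℝ → ℝ → En n → En n → (En n →L[ℝ] En m)}
    (h : DD S T u u' Z Z' c) : DD S T u' u Z' Z c := by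
  intro t s ξ x h0 hts hS hsT
  have a := h t s ξ x h0 hts hS hsT
  exact ⟨by rw [norm_sub_rev]; exact a.1, fun hlt => by rw [norm_sub_rev]; exact a.2 hlt⟩

theorem DD_congr {S c : ℝ} {u u' v v' : ℝ → ℝ → En n → En n → En m}
    {Z Z' W W' : ℝ → ℝ → En n → En n → (En n →L[ℝ] En m)}
    (h : DD S T u u' Z Z' c)
    (h1 : ∀ t s ξ x, 0 ≤ t → t ≤ s → S ≤ s → s ≤ T → v t s ξ x = u t s ξ x ∧
      (t < s → W t s ξ x = Z t s ξ x))
    (h2 : ∀ t s ξ x, 0 ≤ t → t ≤ s → S ≤ s → s ≤ T → v' t s ξ x = u' t s ξ x ∧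
      (t < s → W' t s ξ x = Z' t s ξ x)) : DD S T v v' W W' c := by
  intro t s ξ x h0 hts hS hsT
  have a := h t s ξ x h0 hts hS hsT
  have b1 := h1 t s ξ x h0 hts hS hsT
  have b2 := h2 t s ξ x h0 hts hS hsT
  refine ⟨by rw [b1.1, b2.1]; exact a.1, fun hlt => by rw [b1.2 hlt, b2.2 hlt]; exact a.2 hlt⟩

theorem DD_init {S M N : ℝ} {u u' : ℝ → ℝ → En n → En n → En m}
    {Z Z' : ℝ → ℝ → En n → En n → (En n →L[ℝ] En m)} (hM : 0 ≤ M) (hN : 0 ≤ N) (hT : 0 < T)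
    (h1 : ∀ t s ξ x, 0 ≤ t → t ≤ s → S ≤ s → s ≤ T → ‖u t s ξ x‖ ≤ M ∧
      (t < s → ‖Z t s ξ x‖ ≤ N))
    (h2 : ∀ t s ξ x, 0 ≤ t → t ≤ s → S ≤ s → s ≤ T → ‖u' t s ξ x‖ ≤ M ∧
      (t < s → ‖Z' t s ξ x‖ ≤ N)) : DD S T u u' Z Z' (2 * M + 2 * N * T ^ (1/4 : ℝ)) := by
  intro t s ξ x h0 hts hS hsT
  have b1 := h1 t s ξ x h0 hts hS hsT
  have b2 := h2 t s ξ x h0 hts hS hsT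
  have hp : 0 ≤ 2 * N * T ^ (1/4 : ℝ) := by positivity
  refine ⟨(norm_sub_le _ _).trans (by linarith [b1.1, b2.1]), fun hlt => ?_⟩
  have hr : 0 < s - t := sub_pos.2 hlt
  have f1 : (1:ℝ) ≤ T ^ (1/4 : ℝ) * (s - t) ^ (-(1/4) : ℝ) := by
    have : (s - t) ^ (1/4 : ℝ) ≤ T ^ (1/4 : ℝ) :=
      Real.rpow_le_rpow hr.le (by linarith) (by norm_num)
    calc (1:ℝ) = (s - t) ^ (1/4 : ℝ) * (s - t) ^ (-(1/4) : ℝ) := by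
          rw [← Real.rpow_add hr]; norm_num
      _ ≤ _ := by gcongr
  calc _ ≤ 2 * N * 1 := (norm_sub_le _ _).trans (by linarith [b1.2 hlt, b2.2 hlt])
    _ ≤ 2 * N * (T ^ (1/4 : ℝ) * (s - t) ^ (-(1/4) : ℝ)) := by gcongr
    _ = (0 + 2 * N * T ^ (1/4 : ℝ)) * (s - t) ^ (-(1/4) : ℝ) := by ring
    _ ≤ _ := by gcongr; positivity

open Classical in
def clip1 {V : Type*} [Zero V] (S T : ℝ) (u : ℝ → ℝ → En n → En n → V) :
    ℝ → ℝ → En n → En n → V :=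
  fun t s ξ x => if 0 ≤ t ∧ t ≤ s ∧ S ≤ s ∧ s ≤ T then u t s ξ x else 0

open Classical in
def clip2 {V : Type*} [Zero V] (S T : ℝ) (u : ℝ → ℝ → En n → En n → V) :
    ℝ → ℝ → En n → En n → V :=
  fun t s ξ x => if 0 ≤ t ∧ t < s ∧ S ≤ s ∧ s ≤ T then u t s ξ x else 0

theorem set1_meas (S T : ℝ) : MeasurableSet
    {q : ℝ × ℝ × En n × En n | 0 ≤ q.1 ∧ q.1 ≤ q.2.1 ∧ S ≤ q.2.1 ∧ q.2.1 ≤ T} :=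
  (measurableSet_le measurable_const measurable_fst).inter
    ((measurableSet_le measurable_fst (measurable_fst.comp measurable_snd)).inter
      ((measurableSet_le measurable_const (measurable_fst.comp measurable_snd)).inter
        (measurableSet_le (measurable_fst.comp measurable_snd) measurable_const)))

theorem set2_meas (S T : ℝ) : MeasurableSet
    {q : ℝ × ℝ × En n × En n | 0 ≤ q.1 ∧ q.1 < q.2.1 ∧ S ≤ q.2.1 ∧ q.2.1 ≤ T} :=
  (measurableSet_le measurable_const measurable_fst).inter
    ((measurableSet_lt measurable_fst (measurable_fst.comp measurable_snd)).inter
      ((measurableSet_le measurable_const (measurable_fst.comp measurable_snd)).inter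
        (measurableSet_le (measurable_fst.comp measurable_snd) measurable_const)))

theorem clip1_meas {V : Type*} [Zero V] [MeasurableSpace V] (S T : ℝ)
    {u : ℝ → ℝ → En n → En n → V} (hu : M4 u) : M4 (clip1 S T u) := by
  classical
  exact Measurable.ite (set1_meas S T) hu measurable_const

theorem clip2_meas {V : Type*} [Zero V] [MeasurableSpace V] (S T : ℝ)
    {u : ℝ → ℝ → En n → En n → V} (hu : M4 u) : M4 (clip2 S T u) := by
  classical
  exact Measurable.ite (set2_meas S T) hu measurable_const

theorem clip_eq {V W : Type*} [Zero V] [Zero W] (S T : ℝ) (u : ℝ → ℝ → En n → En n → V)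
    (Z : ℝ → ℝ → En n → En n → W) (t s : ℝ) (ξ x : En n) (h0 : 0 ≤ t) (hts : t ≤ s)
    (hS : S ≤ s) (hsT : s ≤ T) :
    clip1 S T u t s ξ x = u t s ξ x ∧ (t < s → clip2 S T Z t s ξ x = Z t s ξ x) :=
  ⟨if_pos ⟨h0, hts, hS, hsT⟩, fun hlt => if_pos ⟨h0, hlt, hS, hsT⟩⟩

variable (T G g σ) in
/-- Picard iterates. -/
def itr (S : ℝ) : ℕ → (ℝ → ℝ → En n → En n → En m) × (ℝ → ℝ → En n → En n → (En n →L[ℝ] En m))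
  | 0 => (fun _ _ _ _ => 0, fun _ _ _ _ => 0)
  | k + 1 => (clip1 S T (Phi1 T G g σ (itr S k).1 (itr S k).2),
      clip2 S T (Phi2 T G g σ (itr S k).1 (itr S k).2))

theorem itr_meas (hG : KernelHyp n T K0 lam G) (hg : GSHyp n m d L g σ) (S : ℝ) (k : ℕ) :
    M4 (itr T G g σ S k).1 ∧ M4 (itr T G g σ S k).2 := by
  induction k with
  | zero => exact ⟨measurable_const, measurable_const⟩
  | succ k ih => exact ⟨clip1_meas S T (Phi1_meas hG hg ih.1 ih.2),
      clip2_meas S T (Phi2_meas hG hg ih.1 ih.2)⟩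

theorem Phi_bds (hlam : 0 < lam) (hK0 : 0 < K0) (hL : 0 < L) (hG : KernelHyp n T K0 lam G)
    (hg : GSHyp n m d L g σ)
    {u : ℝ → ℝ → En n → En n → En m} {Z : ℝ → ℝ → En n → En n → (En n →L[ℝ] En m)}
    (hu : M4 u) (hZ : M4 Z) {t s : ℝ} (ξ x : En n) (h0 : 0 ≤ s) (hsT : s ≤ T) :
    ‖Phi1 T G g σ u Z t s ξ x‖ ≤ K0 * (Real.pi / lam) ^ ((n : ℝ)/2) * L * T ∧
    ‖Phi2 T G g σ u Z t s ξ x‖ ≤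
      K0 * (Real.pi / lam) ^ ((n : ℝ)/2) * L * (T ^ (1 - 1/2 : ℝ) / (1 - 1/2 : ℝ)) := by
  have hTs : 0 ≤ T - s := sub_nonneg.2 hsT
  have hk : 0 ≤ K0 * (Real.pi / lam) ^ ((n : ℝ)/2) * L := by positivity
  refine ⟨(Phi1_bd hlam hG hg hu hZ ξ x h0 hsT).2.trans ?_,
    (Phi2_bd hlam hG hg hu hZ ξ x h0 hsT).2.trans ?_⟩
  · gcongr; linarith
  · apply mul_le_mul_of_nonneg_left _ hk
    apply div_le_div_of_nonneg_right _ (by norm_num)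
    exact Real.rpow_le_rpow hTs (by linarith) (by norm_num)

theorem itr_bb (hlam : 0 < lam) (hK0 : 0 < K0) (hL : 0 < L) (hG : KernelHyp n T K0 lam G)
    (hg : GSHyp n m d L g σ) (S : ℝ) (k : ℕ) : BB S T (itr T G g σ S k).1 := by
  cases k with
  | zero => exact ⟨0, fun t s ξ x _ _ _ _ => by simp [itr]⟩
  | succ k =>
    refine ⟨K0 * (Real.pi / lam) ^ ((n : ℝ)/2) * L * T, fun t s ξ x h0 hts hS hsT => ?_⟩
    have im := itr_meas hG hg S k
    have := (Phi_bds hlam hK0 hL hG hg im.1 im.2 (t := t) ξ x (h0.trans hts) hsT).1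
    simp only [itr]
    rw [(clip_eq S T (Phi1 T G g σ (itr T G g σ S k).1 (itr T G g σ S k).2)
      (Phi2 T G g σ (itr T G g σ S k).1 (itr T G g σ S k).2) t s ξ x h0 hts hS hsT).1]
    exact this

theorem itr_zero1 (S : ℝ) (k : ℕ) {t s : ℝ} (ξ x : En n)
    (h : ¬ (0 ≤ t ∧ t ≤ s ∧ S ≤ s ∧ s ≤ T)) : (itr T G g σ S k).1 t s ξ x = 0 := by
  cases k with
  | zero => rfl
  | succ k => exact if_neg h

theorem itr_zero2 (S : ℝ) (k : ℕ) {t s : ℝ} (ξ x : En n)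
    (h : ¬ (0 ≤ t ∧ t < s ∧ S ≤ s ∧ s ≤ T)) : (itr T G g σ S k).2 t s ξ x = 0 := by
  cases k with
  | zero => rfl
  | succ k => exact if_neg h

theorem fixed_point (hlam : 0 < lam) (hK0 : 0 < K0) (hL : 0 < L) (hT : 0 < T)
    (hG : KernelHyp n T K0 lam G) (hg : GSHyp n m d L g σ) {S δ : ℝ}
    (hδ : T - S ≤ δ) (hδ1 : δ ≤ 1)
    (hδ2 : 8 * (K0 * (Real.pi / lam) ^ ((n : ℝ)/2)) * AA n T K0 lam L * δ ^ (1/4 : ℝ) ≤ 1) :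
    ∃ (u : ℝ → ℝ → En n → En n → En m) (Z : ℝ → ℝ → En n → En n → (En n →L[ℝ] En m)),
      M4 u ∧ M4 Z ∧ ∀ t s ξ x, 0 ≤ t → t ≤ s → S ≤ s → s ≤ T →
        u t s ξ x = Phi1 T G g σ u Z t s ξ x ∧
        (t < s → Z t s ξ x = Phi2 T G g σ u Z t s ξ x) := by
  have hM : 0 ≤ K0 * (Real.pi / lam) ^ ((n : ℝ)/2) * L * T := by positivity
  have hN : 0 ≤ K0 * (Real.pi / lam) ^ ((n : ℝ)/2) * L * (T ^ (1 - 1/2 : ℝ) / (1 - 1/2 : ℝ)) := by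
    rw [show (1 - 1/2 : ℝ) = 1/2 by norm_num]; positivity
  have im := itr_meas hG hg S
  have ib := itr_bb hlam hK0 hL hG hg S
  obtain ⟨c0, hc0, hinit⟩ : ∃ c0, 0 ≤ c0 ∧ DD S T (itr T G g σ S 0).1 (itr T G g σ S 1).1
      (itr T G g σ S 0).2 (itr T G g σ S 1).2 c0 := by
    refine ⟨_, ?_, DD_init hM hN hT (fun t s ξ x _ _ _ _ => ?_) (fun t s ξ x h0 hts hS hsT => ?_)⟩
    · positivity
    · simp only [itr, norm_zero]; exact ⟨hM, fun _ => hN⟩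
    · have b := Phi_bds hlam hK0 hL hG hg (im 0).1 (im 0).2 (t := t) ξ x (h0.trans hts) hsT
      have e := clip_eq S T (Phi1 T G g σ (itr T G g σ S 0).1 (itr T G g σ S 0).2)
        (Phi2 T G g σ (itr T G g σ S 0).1 (itr T G g σ S 0).2) t s ξ x h0 hts hS hsT
      refine ⟨?_, fun hlt => ?_⟩
      · exact (congrArg norm e.1).trans_le b.1
      · exact (congrArg norm (e.2 hlt)).trans_le b.2
  have hstep : ∀ k, DD S T (itr T G g σ S k).1 (itr T G g σ S (k+1)).1
      (itr T G g σ S k).2 (itr T G g σ S (k+1)).2 (c0 / 2 ^ k) := by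
    intro k
    induction k with
    | zero => simpa using hinit
    | succ k ih =>
      have := contraction hlam hK0 hL hT hG hg (im k).1 (im (k+1)).1 (im k).2 (im (k+1)).2
        (ib k) (ib (k+1)) hδ hδ1 hδ2 (by positivity) ih
      rw [show c0 / 2 ^ k / 2 = c0 / 2 ^ (k+1) by rw [pow_succ]; field_simp] at this
      exact DD_congr this (fun t s ξ x => clip_eq S T _ _ t s ξ x)
        (fun t s ξ x => clip_eq S T _ _ t s ξ x)
  have hd1 : ∀ t s ξ x k, dist ((itr T G g σ S k).1 t s ξ x) ((itr T G g σ S (k+1)).1 t s ξ x)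
      ≤ (2 * c0) / 2 / 2 ^ k := by
    intro t s ξ x k
    by_cases h : 0 ≤ t ∧ t ≤ s ∧ S ≤ s ∧ s ≤ T
    · rw [dist_eq_norm]
      refine ((hstep k) t s ξ x h.1 h.2.1 h.2.2.1 h.2.2.2).1.trans (le_of_eq (by ring))
    · rw [itr_zero1 S k ξ x h, itr_zero1 S (k+1) ξ x h, dist_self]; positivity
  have hd2 : ∀ t s ξ x k, dist ((itr T G g σ S k).2 t s ξ x) ((itr T G g σ S (k+1)).2 t s ξ x)
      ≤ (2 * c0 * |(s - t) ^ (-(1/4) : ℝ)|) / 2 / 2 ^ k := by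
    intro t s ξ x k
    by_cases h : 0 ≤ t ∧ t < s ∧ S ≤ s ∧ s ≤ T
    · rw [dist_eq_norm]
      refine (((hstep k) t s ξ x h.1 h.2.1.le h.2.2.1 h.2.2.2).2 h.2.1).trans ?_
      rw [abs_of_nonneg (Real.rpow_nonneg (by linarith) _)]
      exact (le_of_eq (by ring))
    · rw [itr_zero2 S k ξ x h, itr_zero2 S (k+1) ξ x h, dist_self]; positivity
  have hl1 : ∀ t s ξ x, ∃ y, Tendsto (fun k => (itr T G g σ S k).1 t s ξ x) atTop (𝓝 y) :=
    fun t s ξ x => cauchySeq_tendsto_of_complete (cauchySeq_of_le_geometric_two (hd1 t s ξ x))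
  have hl2 : ∀ t s ξ x, ∃ y, Tendsto (fun k => (itr T G g σ S k).2 t s ξ x) atTop (𝓝 y) :=
    fun t s ξ x => cauchySeq_tendsto_of_complete (cauchySeq_of_le_geometric_two (hd2 t s ξ x))
  choose u hu using hl1
  choose Z hZ using hl2
  have mu : M4 u := measurable_of_tendsto_metrizable (fun k => (im k).1)
    (tendsto_pi_nhds.2 fun q => hu q.1 q.2.1 q.2.2.1 q.2.2.2)
  have mZ : M4 Z := measurable_of_tendsto_metrizable (fun k => (im k).2)
    (tendsto_pi_nhds.2 fun q => hZ q.1 q.2.1 q.2.2.1 q.2.2.2)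
  have hlim : ∀ k, DD S T (itr T G g σ S k).1 u (itr T G g σ S k).2 Z ((2 * c0) / 2 ^ k) := by
    intro k t s ξ x h0 hts hS hsT
    refine ⟨?_, fun hlt => ?_⟩
    · rw [← dist_eq_norm]
      exact dist_le_of_le_geometric_two_of_tendsto (hd1 t s ξ x) (hu t s ξ x) k
    · rw [← dist_eq_norm]
      refine (dist_le_of_le_geometric_two_of_tendsto (hd2 t s ξ x) (hZ t s ξ x) k).trans ?_
      rw [abs_of_nonneg (Real.rpow_nonneg (by linarith) _)]
      exact (le_of_eq (by ring))
  have bu : BB S T u := by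
    refine ⟨2 * c0, fun t s ξ x h0 hts hS hsT => ?_⟩
    have := (hlim 0 t s ξ x h0 hts hS hsT).1
    simpa [itr] using this
  refine ⟨u, Z, mu, mZ, fun t s ξ x h0 hts hS hsT => ?_⟩
  refine DD_zero (C := 2 * c0) (fun k => ?_) ξ x h0 hts hS hsT
  have c1 := contraction hlam hK0 hL hT hG hg (im k).1 mu (im k).2 mZ
        (ib k) bu hδ hδ1 hδ2 (by positivity) (hlim k)
  have c2 : DD S T (itr T G g σ S (k+1)).1 (Phi1 T G g σ u Z) (itr T G g σ S (k+1)).2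
      (Phi2 T G g σ u Z) (2 * c0 / 2 ^ k / 2) :=
    DD_congr c1 (fun t s ξ x => clip_eq S T _ _ t s ξ x) (fun t s ξ x _ _ _ _ => ⟨rfl, fun _ => rfl⟩)
  have := DD_trans (DD_symm (hlim (k+1))) c2
  rwa [show 2 * c0 / 2 ^ (k+1) + 2 * c0 / 2 ^ k / 2 = 2 * c0 / 2 ^ k by
    rw [pow_succ]; field_simp; ring] at this

theorem Smap_eq {θ : ℝ → ℝ → En n → En n → En m} {Z : ℝ → ℝ → En n → En n → (En n →L[ℝ] En m)}
    {t s : ℝ} (ξ x : En n) (h0 : 0 ≤ t) (hts : t ≤ s)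
    (h : ∀ τ ∈ Ioc s T, ∀ η, fderiv ℝ (fun y => θ t τ ξ y) η = Z t τ ξ η) :
    Smap n m d T G g σ θ t s ξ x = Phi1 T G g σ θ Z t s ξ x := by
  unfold Smap Phi1 Fw
  refine setIntegral_congr_fun measurableSet_Ioc fun τ hτ => ?_
  have e : ∀ ηb, fderiv ℝ (fun ξ' => G t ξ' τ ηb) ξ = DG T G t ξ τ ηb := fun ηb =>
    (DG_eq G ξ ηb h0 (hts.trans_lt hτ.1) hτ.2).symm
  simp only [h τ hτ, e]

theorem Ynrm_fin {S p : ℝ} (hp : 1 < p) (h0S : 0 ≤ S) {θ : ℝ → ℝ → En n → En n → En m} {M N : ℝ}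
    (hM : ∀ t s ξ x, 0 ≤ t → t ≤ s → S ≤ s → s ≤ T → ‖θ t s ξ x‖ ≤ M)
    (hN : ∀ t s ξ x, 0 ≤ t → t ≤ s → S ≤ s → s ≤ T → ‖fderiv ℝ (fun y => θ t s ξ y) x‖ ≤ N) :
    Ynrm n m S T p θ ≠ ⊤ := by
  have cast : ∀ {V : Type} [NormedAddCommGroup V] (v : V) (K : ℝ), ‖v‖ ≤ K →
      (‖v‖₊ : ℝ≥0∞) ≤ ENNReal.ofReal K := by
    intro V _ v K hv
    rw [← enorm_eq_nnnorm, ← ofReal_norm_eq_enorm]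
    exact ENNReal.ofReal_le_ofReal hv
  unfold Ynrm
  refine ENNReal.add_ne_top.2 ⟨?_, ?_⟩
  · refine ne_top_of_le_ne_top (b := (ENNReal.ofReal N ^ p * ENNReal.ofReal (T - S)) ^ (1/p)) ?_ ?_
    · refine ENNReal.rpow_ne_top_of_nonneg (by positivity) (ENNReal.mul_ne_top ?_ (by simp))
      exact ENNReal.rpow_ne_top_of_nonneg (by linarith) (by simp)
    · refine iSup_le fun t => ENNReal.rpow_le_rpow ?_ (by positivity)
      calc _ ≤ ∫⁻ s in Ioc (max t.1 S) T, ENNReal.ofReal N ^ p := by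
            refine setLIntegral_mono' measurableSet_Ioc fun s hs => ?_
            refine ENNReal.rpow_le_rpow ?_ (by linarith)
            exact iSup_le fun ξ => iSup_le fun x => cast _ _
              (hN t s ξ x t.2.1 ((le_max_left _ _).trans hs.1.le)
                ((le_max_right _ _).trans hs.1.le) hs.2)
        _ = ENNReal.ofReal N ^ p * ENNReal.ofReal (T - max t.1 S) := by
            rw [setLIntegral_const, Real.volume_Ioc]
        _ ≤ _ := by
            gcongr
            exact le_max_right _ _
  · refine ne_top_of_le_ne_top (b := ENNReal.ofReal M) (by simp) ?_
    exact iSup_le fun t => iSup_le fun s => iSup_le fun ξ => iSup_le fun x => cast _ _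
      (hM t s ξ x t.2.1 ((le_max_left _ _).trans s.2.1) ((le_max_right _ _).trans s.2.1) s.2.2)

end

/-- On a small enough time horizon `T − S ≤ δ`, the nonlinear
integral equation `θ = S[θ]` (the mild form of the coupled representation PDE system
for Type-II BSVIEs) has a unique solution in `Y[S,T]`. -/
theorem stmt_17 (n m d : ℕ) (hn : 1 ≤ n) (hm : 1 ≤ m) (hd : 1 ≤ d)
    (T K0 lam L p : ℝ) (hT : 0 < T) (hK0 : 0 < K0) (hlam : 0 < lam) (hL : 0 < L)
    (hp : 1 < p) (hp2 : p < 2) :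
    ∃ δ : ℝ, 0 < δ ∧
      ∀ (G : ℝ → En n → ℝ → En n → ℝ)
        (g : ℝ → ℝ → En n → En n → En m → (En d →L[ℝ] En m) → (En d →L[ℝ] En m) → En m)
        (σ : ℝ → En n → (En d →L[ℝ] En n)),
        KernelHyp n T K0 lam G → GSHyp n m d L g σ →
        ∀ S : ℝ, 0 ≤ S → S < T → T - S ≤ δ →
        ∃ θ : ℝ → ℝ → En n → En n → En m,
          memY n m S T p θ ∧
          (∀ t ∈ Icc (0:ℝ) T, ∀ s ∈ Icc (max t S) T, ∀ ξ x : En n,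
            θ t s ξ x = Smap n m d T G g σ θ t s ξ x) ∧
          (∀ θ' : ℝ → ℝ → En n → En n → En m,
            memY n m S T p θ' →
            (∀ t ∈ Icc (0:ℝ) T, ∀ s ∈ Icc (max t S) T, ∀ ξ x : En n,
              θ' t s ξ x = Smap n m d T G g σ θ' t s ξ x) →
            ∀ t ∈ Icc (0:ℝ) T, ∀ s ∈ Icc (max t S) T, ∀ ξ x : En n,
              θ' t s ξ x = θ t s ξ x) := by
  set κ := K0 * (Real.pi / lam) ^ ((n : ℝ)/2) with hκ
  have hκ0 : 0 ≤ κ := by positivity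
  have hA : 0 ≤ AA n T K0 lam L := by unfold AA; positivity
  set b : ℝ := 8 * κ * AA n T K0 lam L + 1 with hb
  have hb0 : 0 ≤ 8 * κ * AA n T K0 lam L := by positivity
  have hb1 : 1 ≤ b := by linarith
  have hbinv : b⁻¹ ≤ 1 := inv_le_one_of_one_le₀ hb1
  have hbp : 0 < b⁻¹ := by positivity
  refine ⟨b⁻¹ ^ 4, by positivity, ?_⟩
  have hδ1 : b⁻¹ ^ 4 ≤ 1 := pow_le_one₀ hbp.le hbinv
  have hδ2 : 8 * κ * AA n T K0 lam L * (b⁻¹ ^ 4) ^ (1/4 : ℝ) ≤ 1 := by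
    have : (b⁻¹ ^ 4) ^ (1/4 : ℝ) = b⁻¹ := by
      rw [← Real.rpow_natCast, ← Real.rpow_mul hbp.le]; norm_num
    rw [this, ← div_eq_mul_inv, div_le_one (by linarith)]
    linarith
  intro G g σ hG hg S hS0 hST hδ
  have hM : 0 ≤ κ * L * T := by positivity
  have hN : 0 ≤ κ * L * (T ^ (1 - 1/2 : ℝ) / (1 - 1/2 : ℝ)) := by
    rw [show (1 - 1/2 : ℝ) = 1/2 by norm_num]; positivity
  obtain ⟨u, Z, mu, mZ, huZ⟩ := fixed_point hlam hK0 hL hT hG hg hδ hδ1 hδ2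
  have hder : ∀ (v : ℝ → ℝ → En n → En n → En m) (W : ℝ → ℝ → En n → En n → (En n →L[ℝ] En m)),
      M4 v → M4 W → (∀ t s ξ x, 0 ≤ t → t ≤ s → S ≤ s → s ≤ T →
        v t s ξ x = Phi1 T G g σ v W t s ξ x) →
      ∀ t s ξ x, 0 ≤ t → t ≤ s → S ≤ s → s ≤ T →
        HasFDerivAt (fun y => v t s ξ y) (Phi2 T G g σ v W t s ξ x) x := by
    intro v W mv mW h t s ξ x h0 hts hS hsT
    have e : (fun y => v t s ξ y) = fun y => Phi1 T G g σ v W t s ξ y :=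
      funext fun y => h t s ξ y h0 hts hS hsT
    rw [e]
    exact Phi_deriv hlam hK0 hG hg mv mW ξ x (h0.trans hts) hsT
  have hdu := hder u Z mu mZ (fun t s ξ x h0 hts hS hsT => (huZ t s ξ x h0 hts hS hsT).1)
  have hbds : ∀ t s ξ x, 0 ≤ t → t ≤ s → S ≤ s → s ≤ T → ‖u t s ξ x‖ ≤ κ * L * T ∧
      (t < s → ‖Z t s ξ x‖ ≤ κ * L * (T ^ (1 - 1/2 : ℝ) / (1 - 1/2 : ℝ))) := by
    intro t s ξ x h0 hts hS hsT
    have e := huZ t s ξ x h0 hts hS hsT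
    have b := Phi_bds hlam hK0 hL hG hg mu mZ (t := t) ξ x (h0.trans hts) hsT
    exact ⟨by rw [e.1]; exact b.1, fun hlt => by rw [e.2 hlt]; exact b.2⟩
  refine ⟨u, ⟨mu, ?_, ?_⟩, ?_, ?_⟩
  · intro t ht s hs ξ x
    exact (hdu t s ξ x ht.1 ((le_max_left _ _).trans hs.1) ((le_max_right _ _).trans hs.1)
      hs.2).differentiableAt
  · refine Ynrm_fin hp hS0 (fun t s ξ x h0 hts hS hsT => (hbds t s ξ x h0 hts hS hsT).1)
      (N := κ * L * (T ^ (1 - 1/2 : ℝ) / (1 - 1/2 : ℝ))) (fun t s ξ x h0 hts hS hsT => ?_)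
    rw [(hdu t s ξ x h0 hts hS hsT).fderiv]
    exact (Phi_bds hlam hK0 hL hG hg mu mZ (t := t) ξ x (h0.trans hts) hsT).2
  · intro t ht s hs ξ x
    have hts := (le_max_left _ _).trans hs.1
    have hSs := (le_max_right _ _).trans hs.1
    rw [Smap_eq (Z := Z) ξ x ht.1 hts]
    · exact (huZ t s ξ x ht.1 hts hSs hs.2).1
    · intro τ hτ η
      have htτ := hts.trans_lt hτ.1
      rw [(hdu t τ ξ η ht.1 htτ.le (hSs.trans hτ.1.le) hτ.2).fderiv]
      exact ((huZ t τ ξ η ht.1 htτ.le (hSs.trans hτ.1.le) hτ.2).2 htτ).symm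
  · intro θ' hθ' heq t ht s hs ξ x
    have mem : ∀ {t s : ℝ}, 0 ≤ t → t ≤ s → S ≤ s → s ≤ T → t ∈ Icc (0:ℝ) T ∧
        s ∈ Icc (max t S) T := fun h0 hts hS hsT => ⟨⟨h0, hts.trans hsT⟩, max_le hts hS, hsT⟩
    set W : ℝ → ℝ → En n → En n → (En n →L[ℝ] En m) :=
      clip1 S T (fun t s ξ x => fderiv ℝ (fun y => θ' t s ξ y) x) with hW
    have hWe : ∀ t s ξ x, 0 ≤ t → t ≤ s → S ≤ s → s ≤ T →
        W t s ξ x = fderiv ℝ (fun y => θ' t s ξ y) x := fun t s ξ x h0 hts hS hsT =>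
      if_pos ⟨h0, hts, hS, hsT⟩
    have mv : M4 θ' := hθ'.1
    have mW : M4 W := by
      have h := aux_meas_fderiv (α := ℝ × ℝ × En n) (fun a y => θ' a.1 a.2.1 a.2.2 y)
        (mv.comp (by fun_prop) (by fun_prop) (by fun_prop) (by fun_prop))
        ((fun p : (ℝ × ℝ × En n) × En n => (p.1.1, p.1.2.1, p.1.2.2, p.2)) ⁻¹'
          {q : ℝ × ℝ × En n × En n | 0 ≤ q.1 ∧ q.1 ≤ q.2.1 ∧ S ≤ q.2.1 ∧ q.2.1 ≤ T})
        (measurableSet_preimage (by fun_prop) (set1_meas S T))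
        (fun p hp => hθ'.2.1 _ (mem hp.1 hp.2.1 hp.2.2.1 hp.2.2.2).1 _
          (mem hp.1 hp.2.1 hp.2.2.1 hp.2.2.2).2 _ _)
      have h2 := h.comp (f := fun q : ℝ × ℝ × En n × En n => ((q.1, q.2.1, q.2.2.1), q.2.2.2))
        (by fun_prop)
      refine (congrArg Measurable ?_).mpr h2
      funext q
      by_cases hq : 0 ≤ q.1 ∧ q.1 ≤ q.2.1 ∧ S ≤ q.2.1 ∧ q.2.1 ≤ T
      · refine (hWe _ _ _ _ hq.1 hq.2.1 hq.2.2.1 hq.2.2.2).trans ?_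
        rw [Function.comp_apply, Set.indicator_of_mem]
        exact hq
      · refine (if_neg hq).trans ?_
        rw [Function.comp_apply, Set.indicator_of_notMem]
        exact hq
    have hv1 : ∀ t s ξ x, 0 ≤ t → t ≤ s → S ≤ s → s ≤ T →
        θ' t s ξ x = Phi1 T G g σ θ' W t s ξ x := by
      intro t s ξ x h0 hts hS hsT
      rw [← Smap_eq (Z := W) ξ x h0 hts]
      · exact heq t (mem h0 hts hS hsT).1 s (mem h0 hts hS hsT).2 ξ x
      · intro τ hτ η
        exact (hWe t τ ξ η h0 (hts.trans hτ.1.le) (hS.trans hτ.1.le) hτ.2).symm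
    have hv2 : ∀ t s ξ x, 0 ≤ t → t ≤ s → S ≤ s → s ≤ T →
        W t s ξ x = Phi2 T G g σ θ' W t s ξ x := by
      intro t s ξ x h0 hts hS hsT
      rw [hWe t s ξ x h0 hts hS hsT]
      exact (hder θ' W mv mW hv1 t s ξ x h0 hts hS hsT).fderiv
    have hbds' : ∀ t s ξ x, 0 ≤ t → t ≤ s → S ≤ s → s ≤ T → ‖θ' t s ξ x‖ ≤ κ * L * T ∧
        (t < s → ‖W t s ξ x‖ ≤ κ * L * (T ^ (1 - 1/2 : ℝ) / (1 - 1/2 : ℝ))) := by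
      intro t s ξ x h0 hts hS hsT
      have b := Phi_bds hlam hK0 hL hG hg mv mW (t := t) ξ x (h0.trans hts) hsT
      exact ⟨by rw [hv1 t s ξ x h0 hts hS hsT]; exact b.1,
        fun _ => by rw [hv2 t s ξ x h0 hts hS hsT]; exact b.2⟩
    have hinit := DD_init hM hN hT hbds' hbds
    set c0 := 2 * (κ * L * T) + 2 * (κ * L * (T ^ (1 - 1/2 : ℝ) / (1 - 1/2 : ℝ))) * T ^ (1/4 : ℝ)
      with hc0d
    have hc0 : 0 ≤ c0 := by positivity
    have hall : ∀ k : ℕ, DD S T θ' u W Z (c0 / 2 ^ k) := by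
      intro k
      induction k with
      | zero => simpa using hinit
      | succ k ih =>
        have := contraction hlam hK0 hL hT hG hg mv mu mW mZ
          ⟨_, fun t s ξ x h0 hts hS hsT => (hbds' t s ξ x h0 hts hS hsT).1⟩
          ⟨_, fun t s ξ x h0 hts hS hsT => (hbds t s ξ x h0 hts hS hsT).1⟩
          hδ hδ1 hδ2 (by positivity) ih
        rw [show c0 / 2 ^ k / 2 = c0 / 2 ^ (k+1) by rw [pow_succ]; field_simp] at this
        exact DD_congr this (fun t s ξ x h0 hts hS hsT =>
          ⟨hv1 t s ξ x h0 hts hS hsT, fun _ => hv2 t s ξ x h0 hts hS hsT⟩) huZ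
    exact (DD_zero hall ξ x ht.1 ((le_max_left _ _).trans hs.1)
      ((le_max_right _ _).trans hs.1) hs.2).1

end
end
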